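/- (Lemma 2.12(ii), conditional Itô isometry) Let Assumption (A) and Condition (L) hold (so that M is square-integrable on compact time intervals). Then for all t ≥ s ≥ 0, E°[(M_t − M_s)^2] = E°[[M]_t − [M]_s] almost surely, where E°[ξ] := E[ξ | G]. -/

import Mathlib

open MeasureTheory ProbabilityTheory Filter Set
open scoped RealInnerProductSpace ENNReal NNReal Topology

noncomputable section

namespace PaperC1Ito

variable {Ω : Type*} {m0 : MeasurableSpace Ω}
variable {E : Type*} [NormedAddCommGroup E] [InnerProductSpace ℝ E] [CompleteSpace E]
  [MeasurableSpace E] [BorelSpace E]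

/-- Convergence "uniformly on compacts in probability" of a family of processes indexed by
`ε → 0⁺`. -/
def UCPLimit (P : Measure Ω) (Z : ℝ → ℝ → Ω → ℝ) (L : ℝ → Ω → ℝ) : Prop :=
  ∀ δ : ℝ, 0 < δ → ∀ t : ℝ, 0 < t →
    Tendsto (fun ε : ℝ => P {ω | ∃ s ∈ Icc (0:ℝ) t, δ ≤ |Z ε s ω - L s ω|})
      (𝓝[>] (0:ℝ)) (𝓝 0)

/-- u.c.p. convergence of a sequence of processes. -/
def UCPLimitSeq (P : Measure Ω) (Z : ℕ → ℝ → Ω → ℝ) (L : ℝ → Ω → ℝ) : Prop :=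
  ∀ δ : ℝ, 0 < δ → ∀ t : ℝ, 0 < t →
    Tendsto (fun n => P {ω | ∃ s ∈ Icc (0:ℝ) t, δ ≤ |Z n s ω - L s ω|}) atTop (𝓝 0)

def ucpApproxQC (X Y : ℝ → Ω → ℝ) (ε s : ℝ) (ω : Ω) : ℝ :=
  (1/ε) * ∫ r in Ioc (0:ℝ) s, (X (r+ε) ω - X r ω) * (Y (r+ε) ω - Y r ω)

/-- `C` is the quadratic covariation `[X,Y]` in the regularization sense. -/
def HasQCov (P : Measure Ω) (X Y C : ℝ → Ω → ℝ) : Prop :=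
  UCPLimit P (ucpApproxQC X Y) C

def ucpApproxQV (X : ℝ → Ω → E) (ε s : ℝ) (ω : Ω) : ℝ :=
  (1/ε) * ∫ r in Ioc (0:ℝ) s, ‖X (r+ε) ω - X r ω‖^2

/-- `Q` is the (trace) quadratic variation of the vector-valued process `X`. -/
def HasQVar (P : Measure Ω) (X : ℝ → Ω → E) (Q : ℝ → Ω → ℝ) : Prop :=
  UCPLimit P (ucpApproxQV X) Q

def fiApprox (H N : ℝ → Ω → ℝ) (ε s : ℝ) (ω : Ω) : ℝ :=
  (1/ε) * ∫ r in Ioc (0:ℝ) s, H r ω * (N (r+ε) ω - N r ω)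

/-- `I` is the forward (Russo–Vallois) stochastic integral `∫ H dN`. -/
def IsForwardIntegral (P : Measure Ω) (H N I : ℝ → Ω → ℝ) : Prop :=
  UCPLimit P (fiApprox H N) I

def fiApproxV (H N : ℝ → Ω → E) (ε s : ℝ) (ω : Ω) : ℝ :=
  (1/ε) * ∫ r in Ioc (0:ℝ) s, ⟪H r ω, N (r+ε) ω - N r ω⟫

def IsForwardIntegralV (P : Measure Ω) (H N : ℝ → Ω → E) (I : ℝ → Ω → ℝ) : Prop :=
  UCPLimit P (fiApproxV H N) I

def IsLocalMartingale (ℱ : Filtration ℝ m0) (P : Measure Ω) (M : ℝ → Ω → E) : Prop :=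
  ∃ σ : ℕ → Ω → ℝ, (∀ n, IsStoppingTime ℱ (fun ω => (σ n ω : WithTop ℝ))) ∧
    (∀ᵐ ω ∂P, Tendsto (fun n => σ n ω) atTop atTop) ∧
    ∀ n, Martingale (fun t ω => M (min (σ n ω) t) ω) ℱ P

/-- Orthogonal process: zero covariation with every continuous local martingale. -/
def IsOrthogonal (ℱ : Filtration ℝ m0) (P : Measure Ω) (A : ℝ → Ω → ℝ) : Prop :=
  ∀ N : ℝ → Ω → ℝ, IsLocalMartingale ℱ P N → (∀ᵐ ω ∂P, Continuous fun t => N t ω) →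
    HasQCov P A N 0

def IsOrthogonalV (ℱ : Filtration ℝ m0) (P : Measure Ω) (A : ℝ → Ω → E) : Prop :=
  ∀ N : ℝ → Ω → ℝ, IsLocalMartingale ℱ P N → (∀ᵐ ω ∂P, Continuous fun t => N t ω) →
    ∀ v : E, HasQCov P (fun t ω => ⟪A t ω, v⟫) N 0

def IsCadlagFn (f : ℝ → ℝ) : Prop :=
  ∀ t, ContinuousWithinAt f (Ici t) t ∧ ∃ l, Tendsto f (𝓝[<] t) (𝓝 l)

section RawFiltration

variable {β : Type*} [MeasurableSpace β]

/-- The raw σ-field `σ(Mo_s : 0 ≤ s ≤ t)`. -/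
def gSigma (Mo : ℝ → Ω → β) (t : ℝ) : MeasurableSpace Ω :=
  ⨆ s ∈ Icc (0:ℝ) t, MeasurableSpace.comap (Mo s) inferInstance

/-- The σ-field `σ(Mo_s : s ≥ 0)`. -/
def gSigmaAll (Mo : ℝ → Ω → β) : MeasurableSpace Ω :=
  ⨆ s ∈ Ici (0:ℝ), MeasurableSpace.comap (Mo s) inferInstance

/-- The raw filtration generated by `Mo`. -/
def gFilt (Mo : ℝ → Ω → β) (hMo : ∀ s, Measurable (Mo s)) : Filtration ℝ m0 where
  seq := gSigma Mo
  mono' s t hst := biSup_mono fun r hr => ⟨hr.1, hr.2.trans hst⟩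
  le' t := iSup₂_le fun s _ => measurable_iff_comap_le.mp (hMo s)

end RawFiltration

/-- The Lebesgue–Stieltjes measure associated with a monotone continuous function. -/
def stieltjesMeasure (f : ℝ → ℝ) (hm : Monotone f) (hc : Continuous f) : Measure ℝ :=
  StieltjesFunction.measure ⟨f, hm, fun _ => hc.continuousWithinAt⟩

/-- Membership in the Wasserstein space `P₂(E)`. -/
def MemP2 (μ : Measure E) : Prop :=
  IsProbabilityMeasure μ ∧ Integrable (fun x => ‖x‖^2) μ

/-- The 2-Wasserstein distance. -/
def W2 (μ ν : Measure E) : ℝ :=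
  Real.sqrt (sInf {r : ℝ | ∃ γ : Measure (E × E),
    γ.map Prod.fst = μ ∧ γ.map Prod.snd = ν ∧ r = ∫ p, ‖p.1 - p.2‖^2 ∂γ})

/-- `κ` is (a version of) the conditional law of `X` given the sub-σ-field `G`. -/
def IsCondLaw (P : Measure Ω) (G : MeasurableSpace Ω) (X : Ω → E) (κ : Ω → Measure E) : Prop :=
  (∀ ω, IsProbabilityMeasure (κ ω)) ∧
  ∀ f : E → ℝ, Measurable f → (∀ x, |f x| ≤ 1) →
    (fun ω => ∫ x, f x ∂(κ ω)) =ᵐ[P] P[fun ω => f (X ω) | G]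

/-- `δF` is the linear functional derivative of `F` on `P₂(E)`. -/
def IsLinearFunctionalDeriv (F : Measure E → ℝ) (δF : Measure E → E → ℝ) : Prop :=
  ∀ μ ν : Measure E, MemP2 μ → MemP2 ν →
    F ν - F μ = ∫ t in Icc (0:ℝ) 1,
      ((∫ x, δF (ENNReal.ofReal t • ν + ENNReal.ofReal (1-t) • μ) x ∂ν)
        - ∫ x, δF (ENNReal.ofReal t • ν + ENNReal.ofReal (1-t) • μ) x ∂μ)

/-- Joint continuity in `(t,y,m)` (w.r.t. the 2-Wasserstein distance in `m`). -/
def ContTYM {α : Type*} [NormedAddCommGroup α] (G : ℝ → E → Measure E → α) : Prop :=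
  ∀ t y μ, 0 ≤ t → MemP2 μ → ∀ δ : ℝ, 0 < δ → ∃ η > (0:ℝ), ∀ t' y' μ', 0 ≤ t' → MemP2 μ' →
    |t' - t| < η → ‖y' - y‖ < η → W2 μ' μ < η → ‖G t' y' μ' - G t y μ‖ < δ

/-- Joint continuity in `(t,y,m,x)`. -/
def ContTYMX {α : Type*} [NormedAddCommGroup α] (G : ℝ → E → Measure E → E → α) : Prop :=
  ∀ t y μ x, 0 ≤ t → MemP2 μ → ∀ δ : ℝ, 0 < δ → ∃ η > (0:ℝ),
    ∀ t' y' μ' x', 0 ≤ t' → MemP2 μ' →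
      |t' - t| < η → ‖y' - y‖ < η → W2 μ' μ < η → ‖x' - x‖ < η →
        ‖G t' y' μ' x' - G t y μ x‖ < δ

/-- `F ∈ C^{0,1,1}(ℝ₊ × E × P₂(E))` with partial derivative `DyF` in `y`, linear functional
derivative `δmF` and intrinsic (Lions) derivative `DmF` in the measure variable. -/
structure C011 (F : ℝ → E → Measure E → ℝ) (DyF : ℝ → E → Measure E → E)
    (δmF : ℝ → E → Measure E → E → ℝ) (DmF : ℝ → E → Measure E → E → E) : Prop where
  contF : ContTYM F
  grad_y : ∀ t y μ, 0 ≤ t → MemP2 μ → HasGradientAt (fun y' => F t y' μ) (DyF t y μ) y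
  contDyF : ContTYM DyF
  linDeriv : ∀ t (y : E), 0 ≤ t → IsLinearFunctionalDeriv (F t y) (δmF t y)
  contδmF : ContTYMX δmF
  grad_x : ∀ t y μ x, 0 ≤ t → MemP2 μ → HasGradientAt (δmF t y μ) (DmF t y μ x) x
  contDmF : ContTYMX DmF

/-- The setting of Section 2: a continuous semimartingale
`X_t = X_0 + A_t + M_t + ∫_0^t σ°_s dM°_s` on a filtered probability space, together with
(regularization-limit) quadratic variations `QM = [M]` (trace) and `QMo = [M°]`. -/
structure SettingBase (P : Measure Ω) (ℱ : Filtration ℝ m0)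
    (X A M : ℝ → Ω → E) (Mo : ℝ → Ω → ℝ) (σo : ℝ → Ω → E) (Io : ℝ → Ω → E)
    (QM QMo : ℝ → Ω → ℝ) : Prop where
  hMo_meas : ∀ s, Measurable (Mo s)
  hM_mart : Martingale M ℱ P
  hMo_mart : Martingale Mo ℱ P
  hM_cont : ∀ ω, Continuous fun t => M t ω
  hMo_cont : ∀ ω, Continuous fun t => Mo t ω
  hA_cont : ∀ ω, Continuous fun t => A t ω
  hA_adapted : StronglyAdapted ℱ A
  hA_bv : ∀ ω, ∀ t, 0 ≤ t → BoundedVariationOn (fun r => A r ω) (Icc 0 t)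
  hA0 : ∀ ω, A 0 ω = 0
  hM0 : ∀ ω, M 0 ω = 0
  hMo0 : ∀ ω, Mo 0 ω = 0
  hσo_prog : ProgMeasurable ℱ σo
  /-- `Io` is the stochastic (forward) integral `∫_0^· σ°_s dM°_s`. -/
  hIo : ∀ v : E, IsForwardIntegral P (fun s ω => ⟪σo s ω, v⟫) Mo fun s ω => ⟪Io s ω, v⟫
  hIo0 : ∀ ω, Io 0 ω = 0
  hX_decomp : ∀ t ω, X t ω = X 0 ω + A t ω + M t ω + Io t ω
  hX_meas : ∀ t, Measurable (X t)
  hQM : HasQVar P M QM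
  hQMo : HasQCov P Mo Mo QMo
  hQMo_mono : ∀ ω, Monotone fun t => QMo t ω
  hQMo_cont : ∀ ω, Continuous fun t => QMo t ω

/-- The total variation `|A|_t` of the path `r ↦ A r ω` on `[0, t]`. -/
def totalVar (A : ℝ → Ω → E) (t : ℝ) (ω : Ω) : ℝ :=
  variationOnFromTo (fun r => A r ω) (Icc 0 t) 0 t

/-- Assumption (A) of the paper (with its localizing sequence `τ` of `𝔾`-stopping times). -/
structure SettingA (P : Measure Ω) (ℱ : Filtration ℝ m0)
    (X A M : ℝ → Ω → E) (Mo : ℝ → Ω → ℝ) (σo : ℝ → Ω → E) (Io : ℝ → Ω → E)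
    (QM QMo : ℝ → Ω → ℝ) (τ : ℕ → Ω → ℝ)
    extends SettingBase P ℱ X A M Mo σo Io QM QMo : Prop where
  /-- (A)(i): `τ n` are stopping times of the raw filtration of `M°`. -/
  hτ_stop : ∀ n, IsStoppingTime (gFilt Mo toSettingBase.hMo_meas) (fun ω => (τ n ω : WithTop ℝ))
  hτ_mono : ∀ n ω, τ n ω ≤ τ (n+1) ω
  hτ_tendsto : ∀ᵐ ω ∂P, Tendsto (fun n => τ n ω) atTop atTop
  /-- (A)(i): `E[[M]_{τ_n∧t} + |A|_{τ_n∧t}² + ∫_0^{τ_n∧t} |σ°|² d[M°]] < ∞`. -/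
  hInt : ∀ n : ℕ, ∀ t : ℝ, 0 ≤ t → Integrable (fun ω =>
      QM (min (τ n ω) t) ω + (totalVar A (min (τ n ω) t) ω)^2
      + ∫ s in Ioc (0:ℝ) (min (τ n ω) t), ‖σo s ω‖^2
          ∂(stieltjesMeasure (fun u => QMo u ω)
              (toSettingBase.hQMo_mono ω) (toSettingBase.hQMo_cont ω))) P
  /-- (A)(ii): `[M, N] = 0` for every càdlàg `𝔾`-martingale `N`. -/
  hM_orth : ∀ N : ℝ → Ω → ℝ, Martingale N (gFilt Mo toSettingBase.hMo_meas) P →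
      (∀ᵐ ω ∂P, IsCadlagFn fun t => N t ω) →
      ∀ v : E, HasQCov P (fun t ω => ⟪M t ω, v⟫) N 0
  /-- (A)(iii): the (H)-hypothesis. -/
  hH : ∀ t : ℝ, 0 ≤ t → ∀ D : Set Ω, MeasurableSet[ℱ t] D →
      P[D.indicator (fun _ => (1:ℝ)) | gSigma Mo t]
        =ᵐ[P] P[D.indicator (fun _ => (1:ℝ)) | gSigmaAll Mo]

/-- The setting with the integrability of Assumption (A)(i) holding globally
(`τ_n = ∞` a.s., as in Condition (L) of the paper). -/
structure SettingNoStop (P : Measure Ω) (ℱ : Filtration ℝ m0)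
    (X A M : ℝ → Ω → E) (Mo : ℝ → Ω → ℝ) (σo : ℝ → Ω → E) (Io : ℝ → Ω → E)
    (QM QMo : ℝ → Ω → ℝ)
    extends SettingBase P ℱ X A M Mo σo Io QM QMo : Prop where
  hInt : ∀ t : ℝ, 0 ≤ t → Integrable (fun ω =>
      QM t ω + (totalVar A t ω)^2
      + ∫ s in Ioc (0:ℝ) t, ‖σo s ω‖^2
          ∂(stieltjesMeasure (fun u => QMo u ω)
              (toSettingBase.hQMo_mono ω) (toSettingBase.hQMo_cont ω))) P
  hM_orth : ∀ N : ℝ → Ω → ℝ, Martingale N (gFilt Mo toSettingBase.hMo_meas) P →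
      (∀ᵐ ω ∂P, IsCadlagFn fun t => N t ω) →
      ∀ v : E, HasQCov P (fun t ω => ⟪M t ω, v⟫) N 0
  hH : ∀ t : ℝ, 0 ≤ t → ∀ D : Set Ω, MeasurableSet[ℱ t] D →
      P[D.indicator (fun _ => (1:ℝ)) | gSigma Mo t]
        =ᵐ[P] P[D.indicator (fun _ => (1:ℝ)) | gSigmaAll Mo]

/-- Assumption (B): conditional square-integrability bound for `D_m F` along the interpolated
measures and states. -/
def AssumptionB (P : Measure Ω) (Mo : ℝ → Ω → ℝ) (X : ℝ → Ω → E) (m : ℝ → Ω → Measure E)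
    (τ : ℕ → Ω → ℝ) (DmF : ℝ → E → Measure E → E → E) : Prop :=
  ∀ n : ℕ, ∀ T : ℝ, 0 < T → ∀ K : Set E, IsCompact K →
    ∃ C : ℝ, 0 < C ∧ ∀ r ∈ Icc (0:ℝ) (2*T), ∀ t ∈ Icc (0:ℝ) T, ∀ s ∈ Icc (0:ℝ) t,
      ∀ l ∈ Icc (0:ℝ) 1, ∀ e ∈ Icc (0:ℝ) 1, ∀ y ∈ K,
      ∀ᵐ ω ∂P,
        (P[fun ω' => ‖DmF r y
            (ENNReal.ofReal (1-l) • m (min (τ n ω') s) ω'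
              + ENNReal.ofReal l • m (min (τ n ω') t) ω')
            (X (min (τ n ω') s) ω'
              + e • (X (min (τ n ω') t) ω' - X (min (τ n ω') s) ω'))‖^2
          | gSigmaAll Mo]) ω ≤ C

/-- Assumption (B) with `τ_n = ∞` (Condition (L)). -/
def AssumptionBNoStop (P : Measure Ω) (Mo : ℝ → Ω → ℝ) (X : ℝ → Ω → E)
    (m : ℝ → Ω → Measure E) (DmF : ℝ → E → Measure E → E → E) : Prop :=
  ∀ T : ℝ, 0 < T → ∀ K : Set E, IsCompact K →
    ∃ C : ℝ, 0 < C ∧ ∀ r ∈ Icc (0:ℝ) (2*T), ∀ t ∈ Icc (0:ℝ) T, ∀ s ∈ Icc (0:ℝ) t,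
      ∀ l ∈ Icc (0:ℝ) 1, ∀ e ∈ Icc (0:ℝ) 1, ∀ y ∈ K,
      ∀ᵐ ω ∂P,
        (P[fun ω' => ‖DmF r y
            (ENNReal.ofReal (1-l) • m s ω' + ENNReal.ofReal l • m t ω')
            (X s ω' + e • (X t ω' - X s ω'))‖^2
          | gSigmaAll Mo]) ω ≤ C

/-- `Y` is a continuous weak Dirichlet process with finite quadratic variation, with
decomposition `Y = Y_0 + A^Y + M^Y`. -/
structure WeakDirichlet (P : Measure Ω) (ℱ : Filtration ℝ m0)
    (Y AY MY : ℝ → Ω → E) (QY : ℝ → Ω → ℝ) : Prop where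
  hY_cont : ∀ ω, Continuous fun t => Y t ω
  hY_adapted : StronglyAdapted ℱ Y
  hY_decomp : ∀ t ω, Y t ω = Y 0 ω + AY t ω + MY t ω
  hAY0 : ∀ ω, AY 0 ω = 0
  hMY0 : ∀ ω, MY 0 ω = 0
  hMY : IsLocalMartingale ℱ P MY
  hAY : IsOrthogonalV ℱ P AY
  hQY : HasQVar P Y QY

set_option linter.unusedSectionVars false
set_option linter.unusedSimpArgs false
set_option linter.style.longLine false
set_option linter.unusedVariables false



lemma hlp_L2_tendsto (P : Measure Ω) [IsProbabilityMeasure P] (g : ℕ → Ω → ℝ)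
    (hg : ∀ k, AEStronglyMeasurable (g k) P) (hgi : ∀ k, Integrable (fun ω => (g k ω)^2) P)
    (C : ℝ) (hC : ∀ k, ∫ ω, (g k ω)^2 ∂P ≤ C)
    (hae : ∀ᵐ ω ∂P, Tendsto (fun k => g k ω) atTop (𝓝 0)) :
    Tendsto (fun k => ∫ ω, |g k ω| ∂P) atTop (𝓝 0) := by
  have hC0 : 0 ≤ C := le_trans (integral_nonneg fun ω => sq_nonneg _) (hC 0)
  rw [Metric.tendsto_atTop]
  intro η hη
  set a : ℝ := 2 * (C + 1) / η with ha
  have ha0 : 0 < a := by positivity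
  have hmin : Tendsto (fun k => ∫ ω, min |g k ω| a ∂P) atTop (𝓝 (∫ ω, (0:ℝ) ∂P)) := by
    apply tendsto_integral_of_dominated_convergence (fun _ => a)
    · intro k
      exact ((hg k).norm.inf aestronglyMeasurable_const)
    · exact integrable_const _
    · intro k
      refine Eventually.of_forall fun ω => ?_
      rw [Real.norm_eq_abs, abs_of_nonneg (le_min (abs_nonneg _) ha0.le)]
      exact min_le_right _ _
    · filter_upwards [hae] with ω hω
      have h1 : Tendsto (fun k => min |g k ω| a) atTop (𝓝 (min |0| a)) :=
        (hω.abs).min tendsto_const_nhds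
      simpa [ha0.le] using h1
  rw [integral_zero, Metric.tendsto_atTop] at hmin
  obtain ⟨N, hN⟩ := hmin (η/2) (by positivity)
  refine ⟨N, fun k hk => ?_⟩
  have h1 := hN k hk
  rw [Real.dist_eq, sub_zero] at h1 ⊢
  have hmi : Integrable (fun ω => min |g k ω| a) P := by
    refine Integrable.of_bound ((hg k).norm.inf aestronglyMeasurable_const) a ?_
    refine Eventually.of_forall fun ω => ?_
    rw [Real.norm_eq_abs, abs_of_nonneg (le_min (abs_nonneg _) ha0.le)]
    exact min_le_right _ _
  have h2 : ∫ ω, |g k ω| ∂P ≤ ∫ ω, (min |g k ω| a + (g k ω)^2 / a) ∂P := by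
    apply integral_mono_of_nonneg
    · exact Eventually.of_forall fun ω => abs_nonneg _
    · exact hmi.add ((hgi k).div_const a)
    · refine Eventually.of_forall fun ω => ?_
      simp only
      rcases le_total |g k ω| a with h | h
      · rw [min_eq_left h]
        have : 0 ≤ (g k ω)^2 / a := by positivity
        linarith
      · have : |g k ω| ≤ (g k ω)^2 / a := by
          rw [le_div_iff₀ ha0, ← sq_abs]
          nlinarith [abs_nonneg (g k ω)]
        have := le_min (abs_nonneg (g k ω)) ha0.le
        linarith
  rw [integral_add hmi ((hgi k).div_const a), integral_div] at h2
  have h3 : (∫ ω, (g k ω)^2 ∂P) / a ≤ C / a := by gcongr; exact hC k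
  have h4 : C / a < η / 2 := by
    rw [div_lt_iff₀ ha0, ha]; field_simp; linarith
  rw [abs_of_nonneg (integral_nonneg fun ω => abs_nonneg _)]
  have := le_abs_self (∫ ω, min |g k ω| a ∂P)
  linarith

/-- bounded continuous martingale-like process -/
structure BM (P : Measure Ω) (ℱ : Filtration ℝ m0) (K : ℝ) (X : ℝ → Ω → ℝ) : Prop where
  cont : ∀ ω, Continuous fun t => X t ω
  meas : ∀ r, Measurable (X r)
  bdd : ∀ r ω, |X r ω| ≤ K
  ce : ∀ r u, 0 ≤ r → r ≤ u → P[X u | ℱ r] =ᵐ[P] X r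

section
variable {P : Measure Ω} [IsProbabilityMeasure P] {ℱ : Filtration ℝ m0} {K : ℝ}

lemma BM.K0 {X : ℝ → Ω → ℝ} (h : BM P ℱ K X) : 0 ≤ K := by
  have : Nonempty Ω := nonempty_of_isProbabilityMeasure P
  exact (abs_nonneg _).trans (h.bdd 0 (Classical.arbitrary Ω))

lemma hlp_int_bdd {f : Ω → ℝ} (hf : Measurable f) (C : ℝ) (hC : ∀ ω, |f ω| ≤ C) :
    Integrable f P :=
  Integrable.of_bound hf.aestronglyMeasurable C (Eventually.of_forall hC)

lemma BM.int {X : ℝ → Ω → ℝ} (h : BM P ℱ K X) (r : ℝ) : Integrable (X r) P :=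
  hlp_int_bdd (h.meas r) K (h.bdd r)

lemma BM.aesm {X : ℝ → Ω → ℝ} (h : BM P ℱ K X) {r u : ℝ} (hr : 0 ≤ r) (hu : r ≤ u) :
    AEStronglyMeasurable[ℱ u] (X r) P :=
  ⟨P[X r | ℱ r], stronglyMeasurable_condExp.mono (ℱ.mono hu), (h.ce r r hr le_rfl).symm⟩

lemma BM.orth {X : ℝ → Ω → ℝ} (h : BM P ℱ K X) {r u : ℝ} (hr : 0 ≤ r) (hu : r ≤ u)
    {A : Ω → ℝ} (hA : AEStronglyMeasurable[ℱ r] A P) (hAi : Integrable A P) :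
    ∫ ω, A ω * (X u ω - X r ω) ∂P = 0 := by
  have hi : Integrable (X u - X r) P := (h.int u).sub (h.int r)
  have hAX : Integrable (A * (X u - X r)) P := by
    refine hAi.mul_bdd (c := 2 * K) hi.1 ?_
    refine Eventually.of_forall fun ω => ?_
    rw [Real.norm_eq_abs]
    have h1 := abs_le.1 (h.bdd u ω)
    have h2 := abs_le.1 (h.bdd r ω)
    simp only [Pi.sub_apply]
    exact abs_le.2 ⟨by linarith, by linarith⟩
  have h1 := condExp_mul_of_aestronglyMeasurable_left hA hAX hi
  have h2 : P[X u - X r | ℱ r] =ᵐ[P] 0 := by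
    refine (condExp_sub (h.int u) (h.int r) _).trans ?_
    filter_upwards [h.ce r u hr hu, h.ce r r hr le_rfl] with ω h1 h2
    simp [h1, h2]
  have h3 : ∫ ω, (A * (X u - X r)) ω ∂P = 0 := by
    rw [← integral_condExp (ℱ.le r)]
    rw [integral_congr_ae (g := 0)]
    · simp
    · filter_upwards [h1, h2] with ω h1 h2
      simp [h1, h2]
  simpa using h3

/-- discrete stochastic integral -/
def dS (X Y : ℝ → Ω → ℝ) (ε a : ℝ) (m : ℕ) (ω : Ω) : ℝ :=
  ∑ k ∈ Finset.range m, X (a + k * ε) ω * (Y (a + k * ε + ε) ω - Y (a + k * ε) ω)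

variable {X Y : ℝ → Ω → ℝ}

lemma dS_meas (hX : BM P ℱ K X) (hY : BM P ℱ K Y) (ε a : ℝ) (m : ℕ) :
    Measurable (dS X Y ε a m) := by
  unfold dS
  exact Finset.measurable_sum _ fun k _ => (hX.meas _).mul ((hY.meas _).sub (hY.meas _))

lemma dterm_bdd (hX : BM P ℱ K X) (hY : BM P ℱ K Y) (r s t : ℝ) (ω : Ω) :
    |X r ω * (Y s ω - Y t ω)| ≤ 2 * K^2 := by
  rw [abs_mul]
  have h1 := hX.bdd r ω
  have h2 : |Y s ω - Y t ω| ≤ 2 * K := by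
    have h1 := abs_le.1 (hY.bdd s ω)
    have h2 := abs_le.1 (hY.bdd t ω)
    exact abs_le.2 ⟨by linarith, by linarith⟩
  have := mul_le_mul h1 h2 (abs_nonneg _) hX.K0
  linarith

lemma dS_bdd (hX : BM P ℱ K X) (hY : BM P ℱ K Y) (ε a : ℝ) (m : ℕ) (ω : Ω) :
    |dS X Y ε a m ω| ≤ m * (2 * K^2) := by
  unfold dS
  refine (Finset.abs_sum_le_sum_abs _ _).trans ?_
  refine (Finset.sum_le_card_nsmul _ _ (2 * K^2) fun k _ => dterm_bdd hX hY _ _ _ ω).trans ?_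
  simp

lemma dS_succ (X Y : ℝ → Ω → ℝ) (ε a : ℝ) (m : ℕ) (ω : Ω) : dS X Y ε a (m+1) ω = dS X Y ε a m ω +
    X (a + m * ε) ω * (Y (a + m * ε + ε) ω - Y (a + m * ε) ω) := by
  simp [dS, Finset.sum_range_succ]

lemma dS_aesm (hX : BM P ℱ K X) (hY : BM P ℱ K Y) {ε a : ℝ} (hε : 0 ≤ ε) (ha : 0 ≤ a) (m : ℕ) :
    AEStronglyMeasurable[ℱ (a + m * ε)] (dS X Y ε a m) P := by
  induction m with
  | zero =>
    have : dS X Y ε a 0 = fun _ => 0 := by funext ω; simp [dS]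
    rw [this]; exact stronglyMeasurable_const.aestronglyMeasurable
  | succ m ih =>
    have : dS X Y ε a (m+1) = fun ω => dS X Y ε a m ω +
      X (a + m * ε) ω * (Y (a + m * ε + ε) ω - Y (a + m * ε) ω) := by funext ω; exact dS_succ _ _ _ _ _ _
    rw [this]
    have h0 : 0 ≤ a + m * ε := by positivity
    have h1 : a + m * ε + ε = a + (m+1 : ℕ) * ε := by push_cast; ring
    rw [← h1]
    exact (ih.mono (ℱ.mono (by linarith))).add ((hX.aesm h0 (by linarith)).mul
      ((hY.aesm (by linarith) le_rfl).sub (hY.aesm h0 (by linarith))))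

lemma BM.incr_sq (hY : BM P ℱ K Y) {r u : ℝ} (hr : 0 ≤ r) (hu : r ≤ u) :
    ∫ ω, (Y u ω - Y r ω)^2 ∂P = ∫ ω, (Y u ω)^2 ∂P - ∫ ω, (Y r ω)^2 ∂P := by
  have h := hY.orth hr hu (hY.aesm hr le_rfl) (hY.int r)
  have hsq : ∀ r, Integrable (fun ω => (Y r ω)^2) P := fun r => by
    refine hlp_int_bdd ((hY.meas r).pow_const 2) (K^2) fun ω => ?_
    rw [abs_pow]; exact pow_le_pow_left₀ (abs_nonneg _) (hY.bdd r ω) 2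
  have hpr : Integrable (fun ω => Y r ω * (Y u ω - Y r ω)) P :=
    hlp_int_bdd ((hY.meas r).mul ((hY.meas u).sub (hY.meas r))) (2 * K^2)
      fun ω => dterm_bdd hY hY _ _ _ ω
  have : ∀ ω, (Y u ω - Y r ω)^2 = (Y u ω)^2 - (Y r ω)^2 - 2 * (Y r ω * (Y u ω - Y r ω)) :=
    fun ω => by ring
  simp_rw [this]
  have hs : Integrable (fun ω => (Y u ω)^2 - (Y r ω)^2) P := (hsq u).sub (hsq r)
  rw [integral_sub hs (hpr.const_mul 2), integral_sub (hsq u) (hsq r),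
    integral_const_mul, h]
  ring

lemma dS_int (hX : BM P ℱ K X) (hY : BM P ℱ K Y) {ε a : ℝ} (hε : 0 ≤ ε) (ha : 0 ≤ a) (m : ℕ) :
    ∫ ω, dS X Y ε a m ω ∂P = 0 := by
  induction m with
  | zero => simp [dS]
  | succ m ih =>
    have h0 : 0 ≤ a + m * ε := by positivity
    simp_rw [dS_succ]
    rw [integral_add, ih, hY.orth h0 (by linarith) (hX.aesm h0 le_rfl) (hX.int _)]
    · simp
    · exact hlp_int_bdd (dS_meas hX hY _ _ _) _ (dS_bdd hX hY _ _ _)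
    · exact hlp_int_bdd ((hX.meas _).mul ((hY.meas _).sub (hY.meas _))) _ (dterm_bdd hX hY _ _ _)

lemma dS_sq (hX : BM P ℱ K X) (hY : BM P ℱ K Y) {ε a : ℝ} (hε : 0 ≤ ε) (ha : 0 ≤ a) (m : ℕ) :
    ∫ ω, (dS X Y ε a m ω)^2 ∂P ≤
      K^2 * (∫ ω, (Y (a + m * ε) ω)^2 ∂P - ∫ ω, (Y a ω)^2 ∂P) := by
  induction m with
  | zero => simp [dS]
  | succ m ih =>
    have h0 : 0 ≤ a + m * ε := by positivity
    have e1 : ∀ ω, (dS X Y ε a (m+1) ω)^2 = (dS X Y ε a m ω)^2 +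
      2 * ((dS X Y ε a m ω * X (a + m * ε) ω) * (Y (a + m * ε + ε) ω - Y (a + m * ε) ω)) +
      (X (a + m * ε) ω * (Y (a + m * ε + ε) ω - Y (a + m * ε) ω))^2 := fun ω => by
        rw [dS_succ]; ring
    have iS : Integrable (dS X Y ε a m) P :=
      hlp_int_bdd (dS_meas hX hY _ _ _) _ (dS_bdd hX hY _ _ _)
    have iS2 : Integrable (fun ω => (dS X Y ε a m ω)^2) P := by
      refine hlp_int_bdd ((dS_meas hX hY _ _ _).pow_const 2) ((m * (2 * K^2))^2) fun ω => ?_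
      rw [abs_pow]; exact pow_le_pow_left₀ (abs_nonneg _) (dS_bdd hX hY _ _ _ ω) 2
    have iSX : Integrable (fun ω => dS X Y ε a m ω * X (a + m * ε) ω) P :=
      iS.mul_bdd (c := K) (hX.meas _).aestronglyMeasurable (Eventually.of_forall (hX.bdd _))
    have iD : Integrable (fun ω => (Y (a + m * ε + ε) ω - Y (a + m * ε) ω)) P :=
      (hY.int _).sub (hY.int _)
    have iSXD : Integrable (fun ω => (dS X Y ε a m ω * X (a + m * ε) ω) *
        (Y (a + m * ε + ε) ω - Y (a + m * ε) ω)) P := by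
      have e : ∀ ω, (dS X Y ε a m ω * X (a + m * ε) ω) *
        (Y (a + m * ε + ε) ω - Y (a + m * ε) ω) = dS X Y ε a m ω * (X (a + m * ε) ω *
        (Y (a + m * ε + ε) ω - Y (a + m * ε) ω)) := fun ω => by ring
      simp_rw [e]
      exact iS.mul_bdd (c := 2 * K^2) ((hX.meas _).mul ((hY.meas _).sub (hY.meas _))).aestronglyMeasurable
        (Eventually.of_forall (dterm_bdd hX hY _ _ _))
    have iD2 : Integrable (fun ω => (Y (a + m * ε + ε) ω - Y (a + m * ε) ω)^2) P := by
      refine hlp_int_bdd (((hY.meas _).sub (hY.meas _)).pow_const 2) ((2*K)^2) fun ω => ?_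
      rw [abs_pow]
      refine pow_le_pow_left₀ (abs_nonneg _) ?_ 2
      have h1 := abs_le.1 (hY.bdd (a + m * ε + ε) ω)
      have h2 := abs_le.1 (hY.bdd (a + m * ε) ω)
      exact abs_le.2 ⟨by linarith, by linarith⟩
    have iT2 : Integrable (fun ω => (X (a + m * ε) ω *
        (Y (a + m * ε + ε) ω - Y (a + m * ε) ω))^2) P := by
      refine hlp_int_bdd (((hX.meas _).mul ((hY.meas _).sub (hY.meas _))).pow_const 2)
        ((2*K^2)^2) fun ω => ?_
      rw [abs_pow]
      exact pow_le_pow_left₀ (abs_nonneg _) (dterm_bdd hX hY _ _ _ ω) 2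
    simp_rw [e1]
    have hs : Integrable (fun ω => (dS X Y ε a m ω)^2 +
      2 * ((dS X Y ε a m ω * X (a + m * ε) ω) * (Y (a + m * ε + ε) ω - Y (a + m * ε) ω))) P :=
      iS2.add (iSXD.const_mul 2)
    have horth := hY.orth h0 (show a + m * ε ≤ a + m * ε + ε by linarith) (A := fun ω => dS X Y ε a m ω * X (a + m * ε) ω)
      ((dS_aesm hX hY hε ha m).mul (hX.aesm h0 le_rfl)) iSX
    rw [integral_add hs iT2, integral_add iS2 (iSXD.const_mul 2),
      integral_const_mul,
      horth]
    have h3 : ∫ ω, (X (a + m * ε) ω * (Y (a + m * ε + ε) ω - Y (a + m * ε) ω))^2 ∂P ≤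
        K^2 * ∫ ω, (Y (a + m * ε + ε) ω - Y (a + m * ε) ω)^2 ∂P := by
      rw [← integral_const_mul]
      refine integral_mono iT2 (iD2.const_mul _) fun ω => ?_
      simp only [mul_pow]
      refine mul_le_mul_of_nonneg_right ?_ (sq_nonneg _)
      rw [← sq_abs]
      exact pow_le_pow_left₀ (abs_nonneg _) (hX.bdd _ ω) 2
    rw [hY.incr_sq h0 (by linarith)] at h3
    have e2 : a + ((m+1:ℕ):ℝ) * ε = a + m * ε + ε := by push_cast; ring
    rw [e2]
    nlinarith

end


lemma blk (h : ℝ → ℝ) (hc : Continuous h) (ε : ℝ) (m : ℕ) :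
    ∫ r in (0:ℝ)..(m * ε), h r = ∫ a in (0:ℝ)..ε, ∑ k ∈ Finset.range m, h (a + k * ε) := by
  rw [intervalIntegral.integral_finsetSum]
  · have := intervalIntegral.sum_integral_adjacent_intervals (f := h) (a := fun k : ℕ => (k:ℝ) * ε)
      (n := m) (μ := volume) fun k _ => hc.intervalIntegrable _ _
    simp only [Nat.cast_zero, zero_mul] at this
    rw [← this]
    refine Finset.sum_congr rfl fun k _ => ?_
    rw [intervalIntegral.integral_comp_add_right]
    congr 1 <;> push_cast <;> ring
  · intro k _
    exact (hc.comp (by fun_prop)).intervalIntegrable _ _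

lemma prod_decomp (f g : ℝ → ℝ) (hf : Continuous f) (hg : Continuous g) (ε : ℝ) (hε : 0 < ε) (m : ℕ) :
    ∫ r in Ioc (0:ℝ) (m * ε), (f (r+ε) - f r) * (g (r+ε) - g r) =
    ∫ a in Ioc (0:ℝ) ε, (f (a + m * ε) * g (a + m * ε) - f a * g a
      - (∑ k ∈ Finset.range m, f (a + k * ε) * (g (a + k * ε + ε) - g (a + k * ε)))
      - (∑ k ∈ Finset.range m, g (a + k * ε) * (f (a + k * ε + ε) - f (a + k * ε)))) := by
  rw [← intervalIntegral.integral_of_le (by positivity), ← intervalIntegral.integral_of_le hε.le,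
    blk _ (by fun_prop)]
  congr 1
  funext a
  induction m with
  | zero => simp
  | succ m ih =>
    simp only [Finset.sum_range_succ, ih]
    have : a + ((m+1:ℕ):ℝ) * ε = a + m * ε + ε := by push_cast; ring
    rw [this]; ring

lemma avg_sq (f : ℝ → ℝ) (ε : ℝ) (hε : 0 < ε) (hf : IntegrableOn f (Ioc 0 ε))
    (hf2 : IntegrableOn (fun a => (f a)^2) (Ioc 0 ε)) :
    ((1/ε) * ∫ a in Ioc 0 ε, f a)^2 ≤ (1/ε) * ∫ a in Ioc 0 ε, (f a)^2 := by
  set I := ∫ a in Ioc 0 ε, f a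
  set c := (1/ε) * I with hc
  have h0 : 0 ≤ ∫ a in Ioc 0 ε, (f a - c)^2 := integral_nonneg fun a => sq_nonneg _
  have e : ∀ a, (f a - c)^2 = ((f a)^2 - (2 * c) * f a) + c^2 := fun a => by ring
  have i1 : Integrable (fun a => (f a)^2 - (2 * c) * f a) (volume.restrict (Ioc 0 ε)) :=
    hf2.sub (hf.const_mul _)
  simp_rw [e] at h0
  rw [integral_add i1 (integrable_const _), integral_sub hf2 (hf.const_mul _),
    integral_const_mul, integral_const] at h0
  simp at h0
  rw [max_eq_left hε.le] at h0
  have hI : I = ε * c := by rw [hc]; field_simp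
  change 0 ≤ (∫ a in Ioc 0 ε, (f a)^2) - 2 * c * I + _ at h0
  rw [hI] at h0
  rw [one_div, inv_mul_eq_div, le_div_iff₀ hε]
  nlinarith

section
variable {P : Measure Ω} [IsProbabilityMeasure P] {ℱ : Filtration ℝ m0} {K : ℝ}
variable {X Y : ℝ → Ω → ℝ}

def Wf (X Y : ℝ → Ω → ℝ) (ε : ℝ) (m : ℕ) (a : ℝ) (ω : Ω) : ℝ :=
  X (a + m * ε) ω * Y (a + m * ε) ω - X a ω * Y a ω - dS X Y ε a m ω - dS Y X ε a m ω

lemma qc_eq (hX : BM P ℱ K X) (hY : BM P ℱ K Y) {ε : ℝ} (hε : 0 < ε) (m : ℕ) (ω : Ω) :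
    ucpApproxQC X Y ε (m * ε) ω = (1/ε) * ∫ a in Ioc (0:ℝ) ε, Wf X Y ε m a ω := by
  unfold ucpApproxQC Wf dS
  rw [prod_decomp (fun r => X r ω) (fun r => Y r ω) (hX.cont ω) (hY.cont ω) ε hε m]

lemma Wf_cont (hX : BM P ℱ K X) (hY : BM P ℱ K Y) (ε : ℝ) (m : ℕ) (ω : Ω) :
    Continuous fun a => Wf X Y ε m a ω := by
  unfold Wf dS
  have := hX.cont ω
  have := hY.cont ω
  have hc : ∀ c : ℝ, Continuous fun a => X (a + c) ω := fun c => (hX.cont ω).comp (by fun_prop)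
  have hd : ∀ c : ℝ, Continuous fun a => Y (a + c) ω := fun c => (hY.cont ω).comp (by fun_prop)
  simp_rw [add_assoc]
  fun_prop

lemma Wf_meas (hX : BM P ℱ K X) (hY : BM P ℱ K Y) (ε : ℝ) (m : ℕ) (a : ℝ) :
    Measurable (Wf X Y ε m a) := by
  unfold Wf
  exact ((((hX.meas _).mul (hY.meas _)).sub ((hX.meas _).mul (hY.meas _))).sub
    (dS_meas hX hY _ _ _)).sub (dS_meas hY hX _ _ _)

lemma pr_bdd (hX : BM P ℱ K X) (hY : BM P ℱ K Y) (a b : ℝ) (ω : Ω) :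
    |X a ω * Y b ω| ≤ K^2 := by
  rw [abs_mul, sq]
  exact mul_le_mul (hX.bdd a ω) (hY.bdd b ω) (abs_nonneg _) hX.K0

lemma Wf_bdd (hX : BM P ℱ K X) (hY : BM P ℱ K Y) (ε : ℝ) (m : ℕ) (a : ℝ) (ω : Ω) :
    |Wf X Y ε m a ω| ≤ 2 * K^2 + 2 * (m * (2 * K^2)) := by
  unfold Wf
  have h1 := abs_le.1 (pr_bdd hX hY (a + m * ε) (a + m * ε) ω)
  have h2 := abs_le.1 (pr_bdd hX hY a a ω)
  have h3 := abs_le.1 (dS_bdd hX hY ε a m ω)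
  have h4 := abs_le.1 (dS_bdd hY hX ε a m ω)
  exact abs_le.2 ⟨by linarith, by linarith⟩

lemma Wf_joint (hX : BM P ℱ K X) (hY : BM P ℱ K Y) (ε : ℝ) (m : ℕ) :
    Measurable (Function.uncurry (Wf X Y ε m)) :=
  measurable_uncurry_of_continuous_of_measurable (u := Wf X Y ε m) (Wf_cont hX hY ε m) (Wf_meas hX hY ε m)

lemma Wf_int (hX : BM P ℱ K X) (hY : BM P ℱ K Y) {ε a : ℝ} (hε : 0 ≤ ε) (ha : 0 ≤ a) (m : ℕ) :
    ∫ ω, Wf X Y ε m a ω ∂P = (∫ ω, X (a + m * ε) ω * Y (a + m * ε) ω ∂P) - ∫ ω, X a ω * Y a ω ∂P := by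
  have ip : ∀ b, Integrable (fun ω => X b ω * Y b ω) P := fun b =>
    hlp_int_bdd ((hX.meas _).mul (hY.meas _)) _ (pr_bdd hX hY b b)
  have i1 : Integrable (dS X Y ε a m) P :=
      hlp_int_bdd (dS_meas hX hY _ _ _) _ (dS_bdd hX hY _ _ _)
  have i2 : Integrable (dS Y X ε a m) P :=
      hlp_int_bdd (dS_meas hY hX _ _ _) _ (dS_bdd hY hX _ _ _)
  have i3 : Integrable (fun ω => X (a + m * ε) ω * Y (a + m * ε) ω - X a ω * Y a ω) P :=
    (ip _).sub (ip _)
  have i4 : Integrable (fun ω => X (a + m * ε) ω * Y (a + m * ε) ω - X a ω * Y a ω - dS X Y ε a m ω) P :=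
    i3.sub i1
  unfold Wf
  rw [integral_sub i4 i2, integral_sub i3 i1, integral_sub (ip _) (ip _), dS_int hX hY hε ha,
    dS_int hY hX hε ha]
  ring

lemma Wf_sq (hX : BM P ℱ K X) (hY : BM P ℱ K Y) {ε a : ℝ} (hε : 0 ≤ ε) (ha : 0 ≤ a) (m : ℕ) :
    ∫ ω, (Wf X Y ε m a ω)^2 ∂P ≤ 18 * K^4 := by
  have hs : ∀ {Z : ℝ → Ω → ℝ} (hZ : BM P ℱ K Z) (b : ℝ), ∫ ω, (Z b ω)^2 ∂P ≤ K^2 := by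
    intro Z hZ b
    have : ∫ ω, (Z b ω)^2 ∂P ≤ ∫ ω, K^2 ∂P := by
      refine integral_mono_of_nonneg (Eventually.of_forall fun ω => sq_nonneg _) (integrable_const _)
        (Eventually.of_forall fun ω => ?_)
      simp only
      rw [← sq_abs]; exact pow_le_pow_left₀ (abs_nonneg _) (hZ.bdd b ω) 2
    simpa using this
  have hs0 : ∀ {Z : ℝ → Ω → ℝ} (b : ℝ), 0 ≤ ∫ ω, (Z b ω)^2 ∂P := 
    fun b => integral_nonneg fun ω => sq_nonneg _
  have q1 : ∫ ω, (dS X Y ε a m ω)^2 ∂P ≤ K^4 := by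
    refine (dS_sq hX hY hε ha m).trans ?_
    have h1 := hs hY (a + m * ε)
    have h2 := hs0 (Z := Y) a
    have h3 := mul_le_mul_of_nonneg_left (show (∫ ω, (Y (a + m * ε) ω)^2 ∂P - ∫ ω, (Y a ω)^2 ∂P) ≤ K^2 by linarith) (sq_nonneg K)
    nlinarith
  have q2 : ∫ ω, (dS Y X ε a m ω)^2 ∂P ≤ K^4 := by
    refine (dS_sq hY hX hε ha m).trans ?_
    have h1 := hs hX (a + m * ε)
    have h2 := hs0 (Z := X) a
    have h3 := mul_le_mul_of_nonneg_left (show (∫ ω, (X (a + m * ε) ω)^2 ∂P - ∫ ω, (X a ω)^2 ∂P) ≤ K^2 by linarith) (sq_nonneg K)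
    nlinarith
  have iS : ∀ {X Y : ℝ → Ω → ℝ} (hX : BM P ℱ K X) (hY : BM P ℱ K Y), Integrable (fun ω => (dS X Y ε a m ω)^2) P := by
      intro X Y hX hY
      refine hlp_int_bdd ((dS_meas hX hY _ _ _).pow_const 2) ((m * (2 * K^2))^2) fun ω => ?_
      rw [abs_pow]; exact pow_le_pow_left₀ (abs_nonneg _) (dS_bdd hX hY _ _ _ ω) 2
  have i1 : Integrable (fun ω => 12 * K^4 + 3 * (dS X Y ε a m ω)^2) P :=
    (integrable_const _).add ((iS hX hY).const_mul 3)
  have : ∫ ω, (Wf X Y ε m a ω)^2 ∂P ≤ ∫ ω, (12 * K^4 + 3 * (dS X Y ε a m ω)^2 + 3 * (dS Y X ε a m ω)^2) ∂P := by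
    refine integral_mono_of_nonneg (Eventually.of_forall fun ω => sq_nonneg _)
      (i1.add ((iS hY hX).const_mul 3)) (Eventually.of_forall fun ω => ?_)
    simp only [Wf]
    have h1 := abs_le.1 (pr_bdd hX hY (a + m * ε) (a + m * ε) ω)
    have h2 := abs_le.1 (pr_bdd hX hY a a ω)
    set u := X (a + m * ε) ω * Y (a + m * ε) ω
    set v := X a ω * Y a ω
    set x := dS X Y ε a m ω
    set y := dS Y X ε a m ω
    have h5 : (u - v)^2 ≤ 4 * K^4 := by
      have : |u - v| ≤ 2 * K^2 := abs_le.2 ⟨by linarith, by linarith⟩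
      calc (u-v)^2 = |u-v|^2 := (sq_abs _).symm
        _ ≤ (2*K^2)^2 := pow_le_pow_left₀ (abs_nonneg _) this 2
        _ = _ := by ring
    nlinarith [sq_nonneg ((u-v)+x), sq_nonneg ((u-v)+y), sq_nonneg (x - y)]
  rw [integral_add i1 ((iS hY hX).const_mul 3), integral_add (integrable_const _) ((iS hX hY).const_mul 3),
    integral_const_mul, integral_const_mul] at this
  simp [integral_const_mul] at this
  linarith
end


section
variable {P : Measure Ω} [IsProbabilityMeasure P] {ℱ : Filtration ℝ m0} {K : ℝ}
variable {X Y : ℝ → Ω → ℝ}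

lemma fub_int (W : ℝ → Ω → ℝ) (hW : Measurable (Function.uncurry W)) (C : ℝ) (hC : ∀ a ω, |W a ω| ≤ C)
    (ε : ℝ) : Integrable (fun p : Ω × ℝ => W p.2 p.1) (P.prod (volume.restrict (Ioc 0 ε))) :=
  Integrable.of_bound ((hW.comp measurable_swap).aestronglyMeasurable) C
    (Eventually.of_forall fun p => hC p.2 p.1)

lemma fub_sw (W : ℝ → Ω → ℝ) (hW : Measurable (Function.uncurry W)) (C : ℝ) (hC : ∀ a ω, |W a ω| ≤ C)
    (ε : ℝ) : ∫ ω, (∫ a in Ioc 0 ε, W a ω) ∂P = ∫ a in Ioc 0 ε, (∫ ω, W a ω ∂P) :=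
  integral_integral_swap (f := fun ω a => W a ω) (fub_int W hW C hC ε)

lemma fub_meas (W : ℝ → Ω → ℝ) (hW : Measurable (Function.uncurry W)) (ε : ℝ) :
    Measurable (fun ω => ∫ a in Ioc 0 ε, W a ω) :=
  (StronglyMeasurable.integral_prod_right (f := fun ω a => W a ω) (ν := volume.restrict (Ioc 0 ε))
    (hW.comp measurable_swap).stronglyMeasurable).measurable

lemma qc_meas (hX : BM P ℱ K X) (hY : BM P ℱ K Y) {ε : ℝ} (hε : 0 < ε) (m : ℕ) :
    Measurable (ucpApproxQC X Y ε (m * ε)) := by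
  have : ucpApproxQC X Y ε (m * ε) = fun ω => (1/ε) * ∫ a in Ioc (0:ℝ) ε, Wf X Y ε m a ω := by
    funext ω; exact qc_eq hX hY hε m ω
  rw [this]
  exact (fub_meas _ (Wf_joint hX hY ε m) ε).const_mul _

lemma qc_bdd (hX : BM P ℱ K X) (hY : BM P ℱ K Y) {ε : ℝ} (hε : 0 < ε) (m : ℕ) (ω : Ω) :
    |ucpApproxQC X Y ε (m * ε) ω| ≤ 2 * K^2 + 2 * (m * (2 * K^2)) := by
  rw [qc_eq hX hY hε m ω, abs_mul, abs_of_pos (by positivity), one_div, inv_mul_eq_div,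
    div_le_iff₀ hε]
  have := norm_setIntegral_le_of_norm_le_const (μ := volume) (s := Ioc (0:ℝ) ε) (f := fun a => Wf X Y ε m a ω)
    (C := 2 * K^2 + 2 * (m * (2 * K^2))) (by simp) (fun a _ => Wf_bdd hX hY ε m a ω)
  simpa [Measure.real, hε.le] using this

lemma qc_int (hX : BM P ℱ K X) (hY : BM P ℱ K Y) {ε : ℝ} (hε : 0 < ε) (m : ℕ) :
    ∫ ω, ucpApproxQC X Y ε (m * ε) ω ∂P = (1/ε) * ∫ a in Ioc 0 ε,
      ((∫ ω, X (a + m * ε) ω * Y (a + m * ε) ω ∂P) - ∫ ω, X a ω * Y a ω ∂P) := by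
  simp_rw [qc_eq hX hY hε m]
  rw [integral_const_mul, fub_sw _ (Wf_joint hX hY ε m) _ (Wf_bdd hX hY ε m)]
  congr 1
  refine setIntegral_congr_fun measurableSet_Ioc fun a ha => ?_
  exact Wf_int hX hY hε.le ha.1.le m

lemma qc_sq (hX : BM P ℱ K X) (hY : BM P ℱ K Y) {ε : ℝ} (hε : 0 < ε) (m : ℕ) :
    ∫ ω, (ucpApproxQC X Y ε (m * ε) ω)^2 ∂P ≤ 18 * K^4 := by
  set C := 2 * K^2 + 2 * (m * (2 * K^2)) with hC
  have hj2 : Measurable (Function.uncurry fun a ω => (Wf X Y ε m a ω)^2) :=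
    (Wf_joint hX hY ε m).pow_const 2
  have hb2 : ∀ a ω, |(Wf X Y ε m a ω)^2| ≤ C^2 := fun a ω => by
    rw [abs_pow]; exact pow_le_pow_left₀ (abs_nonneg _) (Wf_bdd hX hY ε m a ω) 2
  have h1 : ∫ ω, (ucpApproxQC X Y ε (m * ε) ω)^2 ∂P ≤
      ∫ ω, (1/ε) * (∫ a in Ioc (0:ℝ) ε, (Wf X Y ε m a ω)^2) ∂P := by
    refine integral_mono_of_nonneg (Eventually.of_forall fun ω => sq_nonneg _) ?_
      (Eventually.of_forall fun ω => ?_)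
    · exact ((fub_int _ hj2 _ hb2 ε).integral_prod_left).const_mul _
    · simp only
      rw [qc_eq hX hY hε m]
      refine avg_sq _ ε hε ?_ ?_
      · exact ((Wf_cont hX hY ε m ω).intervalIntegrable 0 ε).1
      · exact (((Wf_cont hX hY ε m ω).pow 2).intervalIntegrable 0 ε).1
  refine h1.trans ?_
  rw [integral_const_mul, fub_sw _ hj2 _ hb2, one_div, inv_mul_eq_div, div_le_iff₀ hε]
  have : ∫ a in Ioc 0 ε, (∫ ω, (Wf X Y ε m a ω)^2 ∂P) ≤ ∫ a in Ioc 0 ε, 18 * K^4 := by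
    refine setIntegral_mono_on ?_ (integrable_const _) measurableSet_Ioc fun a ha => ?_
    · exact (fub_int _ hj2 _ hb2 ε).integral_prod_right
    · exact Wf_sq hX hY hε.le ha.1.le m
  refine this.trans ?_
  simp [Measure.real, hε.le, mul_comm]

lemma avg_tendsto (φ : ℝ → ℝ) (hφ : Continuous φ) (e : ℕ → ℝ) (he : ∀ k, 0 < e k)
    (het : Tendsto e atTop (𝓝 0)) :
    Tendsto (fun k => (1/e k) * ∫ a in Ioc 0 (e k), φ a) atTop (𝓝 (φ 0)) := by
  have h : HasDerivAt (fun u => ∫ a in (0:ℝ)..u, φ a) (φ 0) 0 :=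
    intervalIntegral.integral_hasDerivAt_right (hφ.intervalIntegrable _ _)
      hφ.aestronglyMeasurable.stronglyMeasurableAtFilter hφ.continuousAt
  have h2 := h.tendsto_slope_zero
  have h3 : Tendsto e atTop (𝓝[≠] 0) :=
    tendsto_nhdsWithin_iff.2 ⟨het, Eventually.of_forall fun k => (he k).ne'⟩
  refine (h2.comp h3).congr fun k => ?_
  simp [intervalIntegral.integral_of_le (he k).le]

lemma prod_lemma (hX : BM P ℱ K X) (hY : BM P ℱ K Y) {T : ℝ} (hT : 0 < T) (mk : ℕ → ℕ)
    (hmk0 : ∀ k, 0 < mk k) (hmk : Tendsto mk atTop atTop) (Q : Ω → ℝ) (hQ : Integrable Q P)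
    (hQ0 : ∀ᵐ ω ∂P, 0 ≤ Q ω)
    (hlim : ∀ᵐ ω ∂P, Tendsto (fun k => max (ucpApproxQC X Y (T / mk k) T ω - Q ω) 0) atTop (𝓝 0)) :
    (∫ ω, X T ω * Y T ω ∂P) - (∫ ω, X 0 ω * Y 0 ω ∂P) ≤ ∫ ω, Q ω ∂P := by
  have hε : ∀ k, 0 < T / mk k := fun k => by have := hmk0 k; positivity
  have hTm : ∀ k, (mk k : ℝ) * (T / mk k) = T := fun k => by
    have : (mk k : ℝ) ≠ 0 := by exact_mod_cast (hmk0 k).ne'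
    field_simp
  have hεt : Tendsto (fun k => T / (mk k : ℝ)) atTop (𝓝 0) :=
    tendsto_const_nhds.div_atTop (tendsto_natCast_atTop_atTop.comp hmk)
  set J : ℕ → Ω → ℝ := fun k ω => ucpApproxQC X Y (T / mk k) T ω with hJ
  have hJm : ∀ k, Measurable (J k) := fun k => by
    have := qc_meas hX hY (hε k) (mk k); rwa [hTm] at this
  have hJb : ∀ k ω, |J k ω| ≤ 2 * K^2 + 2 * (mk k * (2 * K^2)) := fun k ω => by
    have := qc_bdd hX hY (hε k) (mk k) ω; rwa [hTm] at this
  have hJi : ∀ k, Integrable (J k) P := fun k => hlp_int_bdd (hJm k) _ (hJb k)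
  have hJ2i : ∀ k, Integrable (fun ω => (J k ω)^2) P := fun k =>
    hlp_int_bdd ((hJm k).pow_const 2) ((2 * K^2 + 2 * (mk k * (2 * K^2)))^2) fun ω => by
      rw [abs_pow]; exact pow_le_pow_left₀ (abs_nonneg _) (hJb k ω) 2
  have hJ2 : ∀ k, ∫ ω, (J k ω)^2 ∂P ≤ 18 * K^4 := fun k => by
    have := qc_sq hX hY (hε k) (mk k); simp_rw [hTm] at this; exact this
  set φ : ℝ → ℝ := fun a => (∫ ω, X (a + T) ω * Y (a + T) ω ∂P) - ∫ ω, X a ω * Y a ω ∂P with hφ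
  have hJE : ∀ k, ∫ ω, J k ω ∂P = (1/(T / mk k)) * ∫ a in Ioc 0 (T / mk k), φ a := fun k => by
    have := qc_int hX hY (hε k) (mk k); simp_rw [hTm] at this; exact this
  have hψc : Continuous fun a => ∫ ω, X a ω * Y a ω ∂P := by
    refine continuous_of_dominated (bound := fun _ => K^2) ?_ ?_ (integrable_const _) ?_
    · exact fun a => ((hX.meas _).mul (hY.meas _)).aestronglyMeasurable
    · exact fun a => Eventually.of_forall (pr_bdd hX hY a a)
    · exact Eventually.of_forall fun ω => (hX.cont ω).mul (hY.cont ω)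
  have hφc : Continuous φ := (hψc.comp (continuous_add_const T)).sub hψc
  have hEt : Tendsto (fun k => ∫ ω, J k ω ∂P) atTop (𝓝 (φ 0)) := by
    simp_rw [hJE]; exact avg_tendsto φ hφc _ hε hεt
  have hgm : ∀ k, AEStronglyMeasurable (fun ω => max (J k ω - Q ω) 0) P := fun k =>
    (((hJi k).sub hQ).1).sup aestronglyMeasurable_const
  have hgle : ∀ k, ∀ᵐ ω ∂P, (max (J k ω - Q ω) 0)^2 ≤ (J k ω)^2 := fun k => by
    filter_upwards [hQ0] with ω h
    rw [← sq_abs (J k ω)]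
    refine pow_le_pow_left₀ (le_max_right _ _) ?_ 2
    exact max_le (by have := le_abs_self (J k ω); linarith) (abs_nonneg _)
  have hg2i : ∀ k, Integrable (fun ω => (max (J k ω - Q ω) 0)^2) P := fun k => by
    refine (hJ2i k).mono' ((hgm k).pow 2) ?_
    filter_upwards [hgle k] with ω h
    rwa [Real.norm_eq_abs, abs_of_nonneg (sq_nonneg _)]
  have hl := hlp_L2_tendsto P (fun k ω => max (J k ω - Q ω) 0) hgm hg2i (18 * K^4)
    (fun k => (integral_mono_ae (hg2i k) (hJ2i k) (hgle k)).trans (hJ2 k)) hlim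
  have hle : ∀ k, ∫ ω, J k ω ∂P ≤ ∫ ω, Q ω ∂P + ∫ ω, |max (J k ω - Q ω) 0| ∂P := fun k => by
    have hgi : Integrable (fun ω => |max (J k ω - Q ω) 0|) P := ((hJi k).sub hQ).pos_part.abs
    rw [← integral_add hQ hgi]
    refine integral_mono (hJi k) (hQ.add hgi) fun ω => ?_
    simp only
    have h1 := le_max_left (J k ω - Q ω) 0
    have h2 := le_abs_self (max (J k ω - Q ω) 0)
    linarith
  have := le_of_tendsto_of_tendsto' hEt (tendsto_const_nhds.add hl) hle
  simpa [hφ] using this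
end


def RS (ℱ : Filtration ℝ m0) (ρ : Ω → ℝ) : Prop := ∀ r, MeasurableSet[ℱ r] {ω | ρ ω ≤ r}

section
variable {P : Measure Ω} [IsProbabilityMeasure P] {ℱ : Filtration ℝ m0} {M : ℝ → Ω → ℝ}

lemma RS.st {ρ : Ω → ℝ} (h : RS ℱ ρ) : IsStoppingTime ℱ (fun ω => (ρ ω : WithTop ℝ)) := by
  intro r
  have := h r
  simpa [WithTop.coe_le_coe] using this

lemma RS.min_const {ρ : Ω → ℝ} (h : RS ℱ ρ) (u : ℝ) : RS ℱ (fun ω => min (ρ ω) u) := by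
  intro r
  have : {ω | min (ρ ω) u ≤ r} = {ω | ρ ω ≤ r} ∪ {ω | u ≤ r} := by
    ext ω; simp [min_le_iff]
  rw [this]
  exact (h r).union (MeasurableSet.const _)

lemma RS.grid {ρ : Ω → ℝ} (h : RS ℱ ρ) (k : ℕ) : RS ℱ (fun ω => (⌈(k+1:ℝ) * ρ ω⌉ : ℝ) / (k+1)) := by
  intro r
  have hk : (0:ℝ) < k + 1 := by positivity
  have : {ω | (⌈(k+1:ℝ) * ρ ω⌉ : ℝ) / (k+1) ≤ r} = {ω | ρ ω ≤ (⌊(k+1) * r⌋ : ℝ) / (k+1)} := by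
    ext ω
    simp only [Set.mem_ofPred_eq]
    rw [div_le_iff₀ hk, le_div_iff₀ hk, mul_comm r, mul_comm (ρ ω), ← Int.le_floor, Int.ceil_le]
  rw [this]
  refine ℱ.mono ?_ _ (h _)
  rw [div_le_iff₀ hk, mul_comm r]
  exact Int.floor_le _

lemma os_aux (hM : Martingale M ℱ P) (hc : ∀ ω, Continuous fun t => M t ω) {ρ : Ω → ℝ} (hρ : RS ℱ ρ)
    {u : ℝ} (hu : ∀ ω, ρ ω ≤ u) :
    Integrable (fun ω => M (ρ ω) ω) P ∧ ∫ ω, M (ρ ω) ω ∂P = ∫ ω, M u ω ∂P := by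
  set R : ℕ → Ω → ℝ := fun k ω => min ((⌈(k+1:ℝ) * ρ ω⌉ : ℝ) / (k+1)) u with hR
  have hRS : ∀ k, RS ℱ (R k) := fun k => (hρ.grid k).min_const u
  have hRt : ∀ ω, Tendsto (fun k => R k ω) atTop (𝓝 (ρ ω)) := by
    intro ω
    have h1 : Tendsto (fun k : ℕ => (⌈(k+1:ℝ) * ρ ω⌉ : ℝ) / (k+1)) atTop (𝓝 (ρ ω)) := by
      have h2 : Tendsto (fun k : ℕ => ρ ω + 1 / ((k:ℝ)+1)) atTop (𝓝 (ρ ω + 0)) :=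
        tendsto_const_nhds.add tendsto_one_div_add_atTop_nhds_zero_nat
      rw [add_zero] at h2
      refine tendsto_of_tendsto_of_tendsto_of_le_of_le tendsto_const_nhds h2 ?_ ?_
      · intro k
        have hk : (0:ℝ) < k + 1 := by positivity
        simp only
        rw [le_div_iff₀ hk, mul_comm]; exact Int.le_ceil _
      · intro k
        have hk : (0:ℝ) < k + 1 := by positivity
        simp only
        have hx : (ρ ω + 1 / ((k:ℝ)+1)) * (k+1) = (k+1) * ρ ω + 1 := by field_simp
        rw [div_le_iff₀ hk, hx]
        exact (Int.ceil_lt_add_one _).le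
    have := h1.min (tendsto_const_nhds (x := u))
    rwa [min_eq_left (hu ω)] at this
  have hcond : ∀ k, ∃ m : MeasurableSpace Ω, m ≤ m0 ∧ (fun ω => M (R k ω) ω) =ᵐ[P] P[M u | m] := by
    intro k
    have hle : ∀ ω, ((R k ω : ℝ) : WithTop ℝ) ≤ (u : ℝ) := fun ω => WithTop.coe_le_coe.2 (min_le_right _ _)
    have hcr : (Set.range fun ω => ((R k ω : ℝ) : WithTop ℝ)).Countable := by
      have : (Set.range fun ω => ((R k ω : ℝ) : WithTop ℝ)) ⊆
          Set.range (fun z : ℤ => ((min ((z:ℝ) / (k+1)) u : ℝ) : WithTop ℝ)) := by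
        rintro _ ⟨ω, rfl⟩
        exact ⟨⌈(k+1:ℝ) * ρ ω⌉, rfl⟩
      exact (Set.countable_range _).mono this
    refine ⟨_, (hRS k).st.measurableSpace_le_of_le hle, ?_⟩
    exact hM.stoppedValue_ae_eq_condExp_of_le_const_of_countable_range (hRS k).st hle hcr
  choose mm hmm hce using hcond
  have hui0 := (hM.integrable u).uniformIntegrable_condExp hmm
  have hui := (uniformIntegrable_congr_ae hce).2 hui0
  have hae : ∀ᵐ ω ∂P, Tendsto (fun k => M (R k ω) ω) atTop (𝓝 (M (ρ ω) ω)) :=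
    Eventually.of_forall fun ω => ((hc ω).tendsto _).comp (hRt ω)
  have hint : Integrable (fun ω => M (ρ ω) ω) P := hui.integrable_of_ae_tendsto hae
  refine ⟨hint, ?_⟩
  have ht := tendsto_Lp_finite_of_tendsto_ae le_rfl ENNReal.one_ne_top hui.1
    (memLp_one_iff_integrable.2 hint) hui.2.1 hae
  have ht2 := tendsto_integral_of_L1' _ hint.1 (Eventually.of_forall fun k =>
    (integrable_condExp.congr (hce k).symm)) ht
  have he : ∀ k, ∫ ω, M (R k ω) ω ∂P = ∫ ω, M u ω ∂P := fun k => by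
    rw [integral_congr_ae (hce k), integral_condExp (hmm k)]
  simp_rw [he] at ht2
  exact tendsto_nhds_unique ht2 tendsto_const_nhds

def stM (M : ℝ → Ω → ℝ) (ρ : Ω → ℝ) (r : ℝ) (ω : Ω) : ℝ := M (min (ρ ω) (max r 0)) ω

lemma stM_sm (hM : Martingale M ℱ P) (hc : ∀ ω, Continuous fun t => M t ω) {ρ : Ω → ℝ} (hρ : RS ℱ ρ)
    {r : ℝ} (hr : 0 ≤ r) : StronglyMeasurable[ℱ r] (stM M ρ r) := by
  have h := stronglyMeasurable_stoppedValue_of_le (hM.1.isStronglyProgressive_of_continuous hc)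
    (hρ.min_const r).st (n := r) (fun ω => WithTop.coe_le_coe.2 (min_le_right _ _))
  convert h using 1
  funext ω
  simp only [stM, max_eq_left hr, stoppedValue]
  rfl

lemma stM_ce (hM : Martingale M ℱ P) (hc : ∀ ω, Continuous fun t => M t ω) {ρ : Ω → ℝ} (hρ : RS ℱ ρ)
    {r u : ℝ} (hr : 0 ≤ r) (hu : r ≤ u) : P[stM M ρ u | ℱ r] =ᵐ[P] stM M ρ r := by
  have hi : ∀ v, 0 ≤ v → Integrable (stM M ρ v) P := fun v hv => by
    have := (os_aux hM hc (hρ.min_const v) (fun ω => min_le_right _ _)).1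
    unfold stM; simpa [max_eq_left hv] using this
  have hu0 := hr.trans hu
  symm
  refine ae_eq_condExp_of_forall_setIntegral_eq (ℱ.le r) (hi u hu0) (fun s _ _ => (hi r hr).integrableOn)
    ?_ (stM_sm hM hc hρ hr).aestronglyMeasurable
  intro A hA _
  classical
  set σ : Ω → ℝ := fun ω => if ω ∈ A then min (ρ ω) r else min (ρ ω) u with hσ
  have hσRS : RS ℱ σ := by
    intro q
    have : {ω | σ ω ≤ q} = ({ω | ρ ω ≤ q} ∪ (A ∩ {ω | r ≤ q})) ∪ {ω | u ≤ q} := by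
      ext ω
      by_cases h : ω ∈ A
      · simp only [hσ, h, if_true, Set.mem_ofPred_eq, min_le_iff, Set.mem_union, Set.mem_inter_iff, true_and]
        constructor
        · tauto
        · rintro (h | h)
          · exact h
          · exact Or.inr (hu.trans h)
      · simp only [hσ, h, if_false, Set.mem_ofPred_eq, min_le_iff, Set.mem_union, Set.mem_inter_iff, false_and, or_false]
    rw [this]
    refine ((hρ q).union ?_).union (MeasurableSet.const _)
    by_cases h : r ≤ q
    · have : A ∩ {ω | r ≤ q} = A := by ext ω; simp [h]
      rw [this]; exact ℱ.mono h _ hA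
    · have : A ∩ {ω | r ≤ q} = ∅ := by ext ω; simp [h]
      rw [this]; exact @MeasurableSet.empty _ (ℱ q)
  have hσu : ∀ ω, σ ω ≤ u := fun ω => by
    simp only [hσ]; split_ifs
    · exact (min_le_right _ _).trans hu
    · exact min_le_right _ _
  have e1 := (os_aux hM hc hσRS hσu).2
  have e2 := (os_aux hM hc (hρ.min_const u) (fun ω => min_le_right _ _)).2
  have hAm := ℱ.le r _ hA
  have e3 : (fun ω => M (σ ω) ω) = fun ω => stM M ρ u ω + (A.indicator (stM M ρ r) ω - A.indicator (stM M ρ u) ω) := by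
    funext ω
    by_cases h : ω ∈ A
    · simp [hσ, h, stM, max_eq_left hr, max_eq_left hu0]
    · simp [hσ, h, stM, max_eq_left hr, max_eq_left hu0]
  have e4 : (fun ω => M (min (ρ ω) u) ω) = stM M ρ u := by
    funext ω; simp [stM, max_eq_left hu0]
  rw [e4] at e2
  have i3 : Integrable (fun ω => A.indicator (stM M ρ r) ω - A.indicator (stM M ρ u) ω) P :=
    ((hi r hr).indicator hAm).sub ((hi u hu0).indicator hAm)
  rw [e3, integral_add (hi u hu0) i3, integral_sub ((hi r hr).indicator hAm) ((hi u hu0).indicator hAm),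
    integral_indicator hAm, integral_indicator hAm] at e1
  linarith

lemma stM_cont (hc : ∀ ω, Continuous fun t => M t ω) (ρ : Ω → ℝ) (ω : Ω) :
    Continuous fun r => stM M ρ r ω :=
  (hc ω).comp (by fun_prop)

lemma stM_BM (hM : Martingale M ℱ P) (hc : ∀ ω, Continuous fun t => M t ω) {ρ : Ω → ℝ} (hρ : RS ℱ ρ)
    {K : ℝ} (hK : ∀ r ω, |stM M ρ r ω| ≤ K) : BM P ℱ K (stM M ρ) where
  cont := stM_cont hc ρ
  meas r := by
    have : stM M ρ r = stM M ρ (max r 0) := by funext ω; simp [stM]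
    rw [this]
    exact ((stM_sm hM hc hρ (le_max_right r 0)).mono (ℱ.le _)).measurable
  bdd := hK
  ce r u := stM_ce hM hc hρ
end


section
variable {P : Measure Ω} [IsProbabilityMeasure P] {ℱ : Filtration ℝ m0} {M : ℝ → Ω → ℝ}

def hitS (M : ℝ → Ω → ℝ) (T n : ℝ) (ω : Ω) : Set ℝ := {r | r ∈ Icc 0 T ∧ n ≤ |M r ω|} ∪ {T}
def hit (M : ℝ → Ω → ℝ) (T n : ℝ) (ω : Ω) : ℝ := sInf (hitS M T n ω)

lemma hitS_bb {T : ℝ} (hT : 0 ≤ T) (n : ℝ) (ω : Ω) : ∀ r ∈ hitS M T n ω, 0 ≤ r := by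
  rintro r (h | h)
  · exact h.1.1
  · rw [h]; exact hT

lemma hitS_mem (hc : ∀ ω, Continuous fun t => M t ω) {T : ℝ} (hT : 0 ≤ T) (n : ℝ) (ω : Ω) :
    hit M T n ω ∈ hitS M T n ω := by
  refine IsClosed.csInf_mem ?_ ⟨T, Or.inr rfl⟩ ⟨0, fun r hr => hitS_bb hT n ω r hr⟩
  refine IsClosed.union ?_ isClosed_singleton
  exact isClosed_Icc.inter (isClosed_le continuous_const (hc ω).abs)

lemma hit_le {T : ℝ} (hT : 0 ≤ T) {n : ℝ} {ω : Ω} {r : ℝ} (h : r ∈ hitS M T n ω) :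
    hit M T n ω ≤ r := csInf_le ⟨0, fun r hr => hitS_bb hT n ω r hr⟩ h

lemma hit_leT {T : ℝ} (hT : 0 ≤ T) (n : ℝ) (ω : Ω) : hit M T n ω ≤ T := hit_le hT (Or.inr rfl)

lemma hit_nonneg (hc : ∀ ω, Continuous fun t => M t ω) {T : ℝ} (hT : 0 ≤ T) (n : ℝ) (ω : Ω) :
    0 ≤ hit M T n ω := hitS_bb hT n ω _ (hitS_mem hc hT n ω)

lemma hit_RS (hM : StronglyAdapted ℱ M) (hc : ∀ ω, Continuous fun t => M t ω) {T : ℝ} (hT : 0 ≤ T) (n : ℝ) :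
    RS ℱ (hit M T n) := by
  intro q
  by_cases hq : T ≤ q
  · have : {ω | hit M T n ω ≤ q} = Set.univ := by
      ext ω; simp [(hit_leT hT n ω).trans hq]
    rw [this]; exact MeasurableSet.univ
  push Not at hq
  by_cases hq0 : q < 0
  · have : {ω | hit M T n ω ≤ q} = ∅ := by
      ext ω; simp [hq0.trans_le (hit_nonneg hc hT n ω)]
    rw [this]; exact @MeasurableSet.empty _ (ℱ q)
  push Not at hq0
  have : Nonempty (Icc 0 q) := ⟨⟨0, le_rfl, hq0⟩⟩
  have key : {ω | hit M T n ω ≤ q} = ⋂ j : ℕ, ⋃ i : ℕ,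
      {ω | n - 1 / ((j:ℝ)+1) < |M (TopologicalSpace.denseSeq (Icc 0 q) i) ω|} := by
    ext ω
    simp only [Set.mem_ofPred_eq, Set.mem_iInter, Set.mem_iUnion]
    constructor
    · intro h j
      have hm := hitS_mem hc hT n ω
      have hm2 : n ≤ |M (hit M T n ω) ω| := by
        rcases hm with hm | hm
        · exact hm.2
        · rw [Set.mem_singleton_iff] at hm; rw [hm] at h; linarith
      have ho : IsOpen {x : Icc 0 q | n - 1 / ((j:ℝ)+1) < |M x ω|} :=
        isOpen_lt continuous_const ((hc ω).comp continuous_subtype_val).abs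
      obtain ⟨i, hi⟩ := (TopologicalSpace.denseRange_denseSeq (Icc 0 q)).exists_mem_open ho
        ⟨⟨hit M T n ω, hit_nonneg hc hT n ω, h⟩, by
          have : (0:ℝ) < 1 / ((j:ℝ)+1) := by positivity
          simp only [Set.mem_ofPred_eq]; linarith⟩
      exact ⟨i, hi⟩
    · intro h
      obtain ⟨x, hx, hmax⟩ := (isCompact_Icc (a := 0) (b := q)).exists_isMaxOn ⟨0, le_rfl, hq0⟩
        ((hc ω).abs.continuousOn)
      have : n ≤ |M x ω| := by
        by_contra hlt
        push Not at hlt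
        obtain ⟨j, hj⟩ := exists_nat_one_div_lt (sub_pos.2 hlt)
        obtain ⟨i, hi⟩ := h j
        have := hmax (TopologicalSpace.denseSeq (Icc 0 q) i).2
        simp only [Set.mem_ofPred_eq] at this
        linarith
      exact (hit_le hT (Or.inl ⟨⟨hx.1, hx.2.trans hq.le⟩, this⟩)).trans hx.2
  rw [key]
  refine MeasurableSet.iInter fun j => MeasurableSet.iUnion fun i => ?_
  have hm : Measurable[ℱ q] (fun ω => |M (TopologicalSpace.denseSeq (Icc 0 q) i) ω|) := by
    have := ((hM (TopologicalSpace.denseSeq (Icc 0 q) i)).mono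
      (ℱ.mono (TopologicalSpace.denseSeq (Icc 0 q) i).2.2)).norm.measurable
    exact this
  exact hm measurableSet_Ioi

lemma hit_bdd (hc : ∀ ω, Continuous fun t => M t ω) (h0 : ∀ ω, M 0 ω = 0) {T : ℝ} (hT : 0 ≤ T) {n : ℝ}
    (hn : 0 ≤ n) {v : ℝ} {ω : Ω} (hv0 : 0 ≤ v) (hv : v ≤ hit M T n ω) : |M v ω| ≤ n := by
  by_contra hlt
  push Not at hlt
  have hiv := intermediate_value_Icc hv0 (f := fun r => |M r ω|) ((hc ω).abs.continuousOn)
  have : n ∈ Icc (|M 0 ω|) (|M v ω|) := ⟨by rw [h0]; simpa using hn, hlt.le⟩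
  obtain ⟨w, hw, hwn⟩ := hiv this
  simp only at hwn
  have h1 : hit M T n ω ≤ w := hit_le hT (Or.inl ⟨⟨hw.1, hw.2.trans (hv.trans (hit_leT hT n ω))⟩, hwn.ge⟩)
  have h2 : w = v := le_antisymm hw.2 (hv.trans h1)
  rw [h2] at hwn
  linarith

lemma hit_ev (hc : ∀ ω, Continuous fun t => M t ω) {T : ℝ} (hT : 0 ≤ T) (ω : Ω) :
    ∀ᶠ n : ℕ in atTop, hit M T n ω = T := by
  obtain ⟨x, hx, hmax⟩ := (isCompact_Icc (a := 0) (b := T)).exists_isMaxOn ⟨0, le_rfl, hT⟩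
        ((hc ω).abs.continuousOn)
  filter_upwards [eventually_gt_atTop ⌈|M x ω|⌉₊] with n hn
  have hn' : |M x ω| < n := Nat.lt_of_ceil_lt hn
  rcases hitS_mem hc hT n ω with h | h
  · have := hmax h.1
    simp only [Set.mem_ofPred_eq] at this
    have := h.2
    linarith
  · exact h

/-- any stopping time dominated by the hitting time gives a bounded martingale -/
lemma hit_BM (hM : Martingale M ℱ P) (hc : ∀ ω, Continuous fun t => M t ω) (h0 : ∀ ω, M 0 ω = 0) {T : ℝ} (hT : 0 ≤ T)
    {n : ℝ} (hn : 0 ≤ n) {ρ : Ω → ℝ} (hρ : RS ℱ ρ) (hρ0 : ∀ ω, 0 ≤ ρ ω) (hρl : ∀ ω, ρ ω ≤ hit M T n ω) :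
    BM P ℱ n (stM M ρ) :=
  stM_BM hM hc hρ fun r ω => hit_bdd hc h0 hT hn (le_min (hρ0 ω) (le_max_right _ _))
    ((min_le_left _ _).trans (hρl ω))
end


section
variable {P : Measure Ω} [IsProbabilityMeasure P] {ℱ : Filtration ℝ m0} {M : ℝ → Ω → ℝ}

lemma ucp_subseq {Z : ℝ → ℝ → Ω → ℝ} {L : ℝ → Ω → ℝ} (h : UCPLimit P Z L) {T : ℝ} (hT : 0 < T) :
    ∃ mk : ℕ → ℕ, (∀ k, 0 < mk k) ∧ Tendsto mk atTop atTop ∧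
      ∀ᵐ ω ∂P, ∀ δ > 0, ∀ᶠ k in atTop, ∀ s ∈ Icc (0:ℝ) T, |Z (T / mk k) s ω - L s ω| < δ := by
  have hT0 : Tendsto (fun m : ℕ => T / (m:ℝ)) atTop (𝓝[>] 0) := by
    refine tendsto_nhdsWithin_iff.2 ⟨tendsto_const_nhds.div_atTop tendsto_natCast_atTop_atTop, ?_⟩
    filter_upwards [eventually_gt_atTop 0] with m hm
    have : (0:ℝ) < m := by exact_mod_cast hm
    exact div_pos hT this
  have hex : ∀ k : ℕ, ∃ m : ℕ, k + 1 ≤ m ∧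
      P {ω | ∃ s ∈ Icc (0:ℝ) T, 1 / ((k:ℝ)+1) ≤ |Z (T / m) s ω - L s ω|} ≤ (2⁻¹ : ℝ≥0∞)^k := by
    intro k
    have h1 := (h (1 / ((k:ℝ)+1)) (by positivity) T hT).comp hT0
    have h2 : ∀ᶠ m : ℕ in atTop, P {ω | ∃ s ∈ Icc (0:ℝ) T, 1 / ((k:ℝ)+1) ≤ |Z (T / m) s ω - L s ω|} < (2⁻¹ : ℝ≥0∞)^k :=
      h1.eventually_lt_const (ENNReal.pow_pos (by simp) k)
    obtain ⟨m, hm1, hm2⟩ := (h2.and (eventually_ge_atTop (k+1))).exists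
    exact ⟨m, hm2, hm1.le⟩
  choose mk hmk hP using hex
  refine ⟨mk, fun k => by have := hmk k; omega, ?_, ?_⟩
  · exact tendsto_atTop_mono (fun k => by have := hmk k; simp only [id]; omega) tendsto_id
  · have hsum : ∑' k : ℕ, P {ω | ∃ s ∈ Icc (0:ℝ) T, 1 / ((k:ℝ)+1) ≤ |Z (T / mk k) s ω - L s ω|} ≠ ∞ := by
      refine ne_top_of_le_ne_top ?_ (ENNReal.tsum_le_tsum hP)
      rw [ENNReal.tsum_geometric]
      simp
    filter_upwards [ae_eventually_notMem hsum] with ω hω δ hδ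
    obtain ⟨j, hj⟩ := exists_nat_one_div_lt hδ
    filter_upwards [hω, eventually_ge_atTop j] with k hk hkj s hs
    simp only [Set.mem_ofPred_eq, not_exists, not_and, not_le] at hk
    refine (hk s hs).trans (lt_of_le_of_lt ?_ hj)
    gcongr

lemma qv_eq (M : ℝ → Ω → ℝ) : ucpApproxQV M = ucpApproxQC M M := by
  funext ε s ω
  simp [ucpApproxQV, ucpApproxQC, ← sq]

lemma qc_contS {X Y : ℝ → Ω → ℝ} {ω : Ω} (hX : Continuous fun t => X t ω) (hY : Continuous fun t => Y t ω)
    (ε T : ℝ) : ContinuousOn (fun s => ucpApproxQC X Y ε s ω) (Icc 0 T) := by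
  have hc : Continuous fun r => (X (r+ε) ω - X r ω) * (Y (r+ε) ω - Y r ω) :=
    ((hX.comp (continuous_add_const ε)).sub hX).mul ((hY.comp (continuous_add_const ε)).sub hY)
  have h1 : Continuous fun s => (1/ε) * ∫ r in (0:ℝ)..s, (X (r+ε) ω - X r ω) * (Y (r+ε) ω - Y r ω) :=
    continuous_const.mul (intervalIntegral.continuous_primitive (fun a b => hc.intervalIntegrable a b) 0)
  refine h1.continuousOn.congr fun s hs => ?_
  simp only [ucpApproxQC]
  rw [intervalIntegral.integral_of_le hs.1]

lemma qc_self_mono {X : ℝ → Ω → ℝ} {ω : Ω} (hX : Continuous fun t => X t ω)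
    {ε s t : ℝ} (hε : 0 < ε) (hst : s ≤ t) : ucpApproxQC X X ε s ω ≤ ucpApproxQC X X ε t ω := by
  have hc : Continuous fun r => (X (r+ε) ω - X r ω) * (X (r+ε) ω - X r ω) :=
    ((hX.comp (continuous_add_const ε)).sub hX).mul ((hX.comp (continuous_add_const ε)).sub hX)
  unfold ucpApproxQC
  refine mul_le_mul_of_nonneg_left ?_ (by positivity)
  refine setIntegral_mono_set (hc.integrableOn_Ioc) (Eventually.of_forall fun r => mul_self_nonneg _) ?_
  exact (Ioc_subset_Ioc_right hst).eventuallyLE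

lemma qc_zero {X Y : ℝ → Ω → ℝ} (ε : ℝ) (ω : Ω) : ucpApproxQC X Y ε 0 ω = 0 := by
  simp [ucpApproxQC]

lemma qc_measM (hm : ∀ r, Measurable (M r)) (hc : ∀ ω, Continuous fun t => M t ω) (ε s : ℝ) :
    Measurable (ucpApproxQC M M ε s) := by
  have hj : Measurable (Function.uncurry fun r ω => (M (r+ε) ω - M r ω) * (M (r+ε) ω - M r ω)) := by
    refine measurable_uncurry_of_continuous_of_measurable (fun ω => ?_) (fun r => ?_)
    · exact (((hc ω).comp (continuous_add_const ε)).sub (hc ω)).mul (((hc ω).comp (continuous_add_const ε)).sub (hc ω))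
    · exact ((hm _).sub (hm _)).mul ((hm _).sub (hm _))
  exact (fub_meas _ hj s).const_mul _

/-- good event for the quadratic variation -/
structure QGood (M Q : ℝ → Ω → ℝ) (T : ℝ) (mk : ℕ → ℕ) (ω : Ω) : Prop where
  unif : ∀ δ > 0, ∀ᶠ k in atTop, ∀ s ∈ Icc (0:ℝ) T, |ucpApproxQC M M (T / mk k) s ω - Q s ω| < δ
  cont : ContinuousOn (fun s => Q s ω) (Icc 0 T)
  mono : ∀ s ∈ Icc 0 T, ∀ t ∈ Icc 0 T, s ≤ t → Q s ω ≤ Q t ω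
  zero : Q 0 ω = 0

lemma QGood.tend {Q : ℝ → Ω → ℝ} {T : ℝ} {mk : ℕ → ℕ} {ω : Ω} (h : QGood M Q T mk ω) {s : ℝ} (hs : s ∈ Icc 0 T) :
    Tendsto (fun k => ucpApproxQC M M (T / mk k) s ω) atTop (𝓝 (Q s ω)) := by
  rw [Metric.tendsto_nhds]
  intro δ hδ
  filter_upwards [h.unif δ hδ] with k hk
  exact hk s hs

lemma QGood.nonneg {Q : ℝ → Ω → ℝ} {T : ℝ} {mk : ℕ → ℕ} {ω : Ω} (h : QGood M Q T mk ω) {s : ℝ} (hs : s ∈ Icc 0 T) :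
    0 ≤ Q s ω := by
  rw [← h.zero]; exact h.mono 0 ⟨le_rfl, hs.1.trans hs.2⟩ s hs hs.1

lemma qgood_ae {Q : ℝ → Ω → ℝ} (hc : ∀ ω, Continuous fun t => M t ω) (h : HasQVar P M Q) {T : ℝ} (hT : 0 < T) :
    ∃ mk : ℕ → ℕ, (∀ k, 0 < mk k) ∧ Tendsto mk atTop atTop ∧ ∀ᵐ ω ∂P, QGood M Q T mk ω := by
  unfold HasQVar at h
  rw [qv_eq] at h
  obtain ⟨mk, h0, ht, hae⟩ := ucp_subseq h hT
  refine ⟨mk, h0, ht, ?_⟩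
  filter_upwards [hae] with ω hω
  have hε : ∀ k, 0 < T / mk k := fun k => by have := h0 k; positivity
  have tend : ∀ s ∈ Icc 0 T, Tendsto (fun k => ucpApproxQC M M (T / mk k) s ω) atTop (𝓝 (Q s ω)) := by
    intro s hs
    rw [Metric.tendsto_nhds]
    intro δ hδ
    filter_upwards [hω δ hδ] with k hk
    exact hk s hs
  refine ⟨hω, ?_, ?_, ?_⟩
  · have hu : TendstoUniformlyOn (fun k s => ucpApproxQC M M (T / mk k) s ω) (fun s => Q s ω) atTop (Icc 0 T) := by
      rw [Metric.tendstoUniformlyOn_iff]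
      intro δ hδ
      filter_upwards [hω δ hδ] with k hk s hs
      rw [dist_comm]; exact hk s hs
    exact hu.continuousOn (Eventually.of_forall fun k => qc_contS (hc ω) (hc ω) _ _).frequently
  · intro s hs t ht hst
    exact le_of_tendsto_of_tendsto' (tend s hs) (tend t ht) fun k => qc_self_mono (hc ω) (hε k) hst
  · have := tend 0 ⟨le_rfl, hT.le⟩
    simp_rw [qc_zero] at this
    exact tendsto_nhds_unique this tendsto_const_nhds

end

lemma qm_integrable {P : Measure Ω} [IsProbabilityMeasure P] {ℱ : Filtration ℝ m0}
    {X A M Mo σo Io QM QMo : ℝ → Ω → ℝ}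
    (hS : SettingNoStop P ℱ X A M Mo σo Io QM QMo) {t : ℝ} (ht : 0 ≤ t) : Integrable (QM t) P := by
  obtain ⟨mk, h0, hmt, hae⟩ := qgood_ae hS.hM_cont hS.hQM (show 0 < t + 1 by linarith)
  have hm : ∀ r, Measurable (M r) := fun r => ((hS.hM_mart.1 r).mono (ℱ.le r)).measurable
  have htm : t ∈ Icc 0 (t+1) := ⟨ht, by linarith⟩
  have hme : AEStronglyMeasurable (QM t) P :=
    aestronglyMeasurable_of_tendsto_ae atTop
      (fun k => (qc_measM hm hS.hM_cont ((t+1) / mk k) t).aestronglyMeasurable)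
      (by filter_upwards [hae] with ω hω using hω.tend htm)
  refine (hS.hInt t ht).mono' hme ?_
  filter_upwards [hae] with ω hω
  rw [Real.norm_eq_abs, abs_of_nonneg (hω.nonneg htm)]
  have h1 := sq_nonneg (totalVar A t ω)
  have h2 : 0 ≤ ∫ s in Ioc (0:ℝ) t, ‖σo s ω‖^2
          ∂(stieltjesMeasure (fun u => QMo u ω) (hS.hQMo_mono ω) (hS.hQMo_cont ω)) :=
    integral_nonneg fun s => by positivity
  linarith


lemma edge (h1 h2 : ℝ → ℝ) {ρ T ε c : ℝ} (hρ0 : 0 ≤ ρ) (hρT : ρ ≤ T) (hε : 0 < ε)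
    (hi1 : IntegrableOn h1 (Ioc 0 ρ)) (hi2 : IntegrableOn h2 (Ioc 0 ρ)) (hc : 0 ≤ c)
    (ha : ∀ r, ρ < r → h1 r = 0) (hb : ∀ r, 0 < r → r ≤ ρ - ε → h1 r = h2 r)
    (hd : ∀ r, 0 < r → r ≤ ρ → ρ - ε < r → |h1 r - h2 r| ≤ c) :
    |(1/ε) * (∫ r in Ioc 0 T, h1 r) - (1/ε) * ∫ r in Ioc 0 ρ, h2 r| ≤ c := by
  have e1 : ∫ r in Ioc 0 T, h1 r = ∫ r in Ioc 0 ρ, h1 r := by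
    refine setIntegral_eq_of_subset_of_forall_sdiff_eq_zero measurableSet_Ioc (Ioc_subset_Ioc_right hρT) ?_
    intro r hr
    refine ha r ?_
    by_contra h
    exact hr.2 ⟨hr.1.1, not_lt.1 h⟩
  have e2 : (∫ r in Ioc 0 ρ, (h1 r - h2 r)) = ∫ r in Ioc (max 0 (ρ - ε)) ρ, (h1 r - h2 r) := by
    refine setIntegral_eq_of_subset_of_forall_sdiff_eq_zero measurableSet_Ioc
      (Ioc_subset_Ioc_left (le_max_left _ _)) ?_
    intro r hr
    have : r ≤ ρ - ε := by
      by_contra h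
      exact hr.2 ⟨max_lt hr.1.1 (not_le.1 h), hr.1.2⟩
    rw [hb r hr.1.1 this, sub_self]
  rw [e1, ← mul_sub, ← integral_sub hi1 hi2, e2, abs_mul, abs_of_pos (by positivity), one_div,
    inv_mul_eq_div, div_le_iff₀ hε]
  have := norm_setIntegral_le_of_norm_le_const (μ := volume) (s := Ioc (max 0 (ρ - ε)) ρ)
    (f := fun r => h1 r - h2 r) (C := c) (by simp)
    (fun r hr => hd r ((le_max_left _ _).trans_lt hr.1) hr.2 ((le_max_right _ _).trans_lt hr.1))
  refine this.trans (mul_le_mul_of_nonneg_left ?_ hc)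
  simp only [Measure.real, Real.volume_Ioc]
  rw [ENNReal.toReal_ofReal (by rw [sub_nonneg]; exact max_le hρ0 (by linarith))]
  have := le_max_right 0 (ρ - ε)
  linarith

section
variable {M : ℝ → Ω → ℝ} {ρ : Ω → ℝ} {ω : Ω}

lemma stM_gt {r : ℝ} (hr0 : 0 ≤ r) (h : ρ ω ≤ r) : stM M ρ r ω = M (ρ ω) ω := by
  simp [stM, max_eq_left hr0, min_eq_left h]

lemma stM_lt {r : ℝ} (hr0 : 0 ≤ r) (h : r ≤ ρ ω) : stM M ρ r ω = M r ω := by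
  simp [stM, max_eq_left hr0, min_eq_right h]

lemma edge_U {U : ℝ → Ω → ℝ} (hcM : Continuous fun t => M t ω) (hcU : Continuous fun t => U t ω)
    (hρ0 : 0 ≤ ρ ω) {T : ℝ} (hρT : ρ ω ≤ T) {ε η K : ℝ} (hε : 0 < ε) (hK : ∀ r, |U r ω| ≤ K)
    (hη : ∀ r, |r - ρ ω| ≤ ε → |M r ω - M (ρ ω) ω| ≤ η) :
    |ucpApproxQC U (stM M ρ) ε T ω - ucpApproxQC U M ε (ρ ω) ω| ≤ 2 * K * η := by
  have hcN : Continuous fun t => stM M ρ t ω := hcM.comp (by fun_prop)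
  have hK0 : 0 ≤ K := (abs_nonneg _).trans (hK 0)
  have hη0 : 0 ≤ η := (abs_nonneg _).trans (hη (ρ ω) (by simpa using hε.le))
  have i1 : ∀ {Y : ℝ → Ω → ℝ}, (Continuous fun t => Y t ω) →
      Continuous fun r => (U (r+ε) ω - U r ω) * (Y (r+ε) ω - Y r ω) := fun hY =>
    ((hcU.comp (continuous_add_const ε)).sub hcU).mul ((hY.comp (continuous_add_const ε)).sub hY)
  refine edge _ _ hρ0 hρT hε (i1 hcN).integrableOn_Ioc (i1 hcM).integrableOn_Ioc (by positivity) ?_ ?_ ?_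
  · intro r hr
    rw [stM_gt (by linarith) (by linarith), stM_gt (by linarith) hr.le]; ring
  · intro r h0 hr
    rw [stM_lt (by linarith) (by linarith), stM_lt h0.le (by linarith)]
  · intro r h0 hr1 hr2
    rw [stM_gt (by linarith) (by linarith), stM_lt h0.le hr1, ← mul_sub, abs_mul]
    have h1 : |U (r+ε) ω - U r ω| ≤ 2 * K := by
      have h1 := abs_le.1 (hK (r+ε))
      have h2 := abs_le.1 (hK r)
      exact abs_le.2 ⟨by linarith, by linarith⟩
    have h2 : |M (ρ ω) ω - M r ω - (M (r+ε) ω - M r ω)| ≤ η := by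
      rw [show M (ρ ω) ω - M r ω - (M (r+ε) ω - M r ω) = -(M (r+ε) ω - M (ρ ω) ω) by ring, abs_neg]
      exact hη _ (abs_le.2 ⟨by linarith, by linarith⟩)
    exact mul_le_mul h1 h2 (abs_nonneg _) (by positivity)

lemma edge_N (hcM : Continuous fun t => M t ω)
    (hρ0 : 0 ≤ ρ ω) {T : ℝ} (hρT : ρ ω ≤ T) {ε η : ℝ} (hε : 0 < ε)
    (hη : ∀ r, |r - ρ ω| ≤ ε → |M r ω - M (ρ ω) ω| ≤ η) :
    |ucpApproxQC (stM M ρ) (stM M ρ) ε T ω - ucpApproxQC M M ε (ρ ω) ω| ≤ 5 * η^2 := by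
  have hcN : Continuous fun t => stM M ρ t ω := hcM.comp (by fun_prop)
  have hη0 : 0 ≤ η := (abs_nonneg _).trans (hη (ρ ω) (by simpa using hε.le))
  have i1 : ∀ {Y : ℝ → Ω → ℝ}, (Continuous fun t => Y t ω) →
      Continuous fun r => (Y (r+ε) ω - Y r ω) * (Y (r+ε) ω - Y r ω) := fun hY =>
    ((hY.comp (continuous_add_const ε)).sub hY).mul ((hY.comp (continuous_add_const ε)).sub hY)
  refine edge _ _ hρ0 hρT hε (i1 hcN).integrableOn_Ioc (i1 hcM).integrableOn_Ioc (by positivity) ?_ ?_ ?_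
  · intro r hr
    rw [stM_gt (by linarith) (by linarith), stM_gt (by linarith) hr.le]; ring
  · intro r h0 hr
    rw [stM_lt (by linarith) (by linarith), stM_lt h0.le (by linarith)]
  · intro r h0 hr1 hr2
    rw [stM_gt (by linarith) (by linarith), stM_lt h0.le hr1]
    have h1 := abs_le.1 (hη r (abs_le.2 ⟨by linarith, by linarith⟩))
    have h2 := abs_le.1 (hη (r+ε) (abs_le.2 ⟨by linarith, by linarith⟩))
    set a := M r ω - M (ρ ω) ω
    set b := M (r+ε) ω - M (ρ ω) ω
    have e1 : M (ρ ω) ω - M r ω = -a := by simp [a]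
    have e2 : M (r+ε) ω - M r ω = b - a := by simp [a, b]
    rw [e1, e2]
    have ha : a^2 ≤ η^2 := sq_le_sq' h1.1 h1.2
    have hb : b^2 ≤ η^2 := sq_le_sq' h2.1 h2.2
    exact abs_le.2 ⟨by nlinarith [sq_nonneg (a+b)], by nlinarith [sq_nonneg (b-a)]⟩

lemma ev_eta (hcM : Continuous fun t => M t ω) (x : ℝ) {e : ℕ → ℝ} (het : Tendsto e atTop (𝓝 0)) {η : ℝ} (hη : 0 < η) :
    ∀ᶠ k in atTop, ∀ r, |r - x| ≤ e k → |M r ω - M x ω| ≤ η := by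
  obtain ⟨δ, hδ, h⟩ := Metric.continuous_iff.1 hcM x η hη
  filter_upwards [het.eventually_lt_const hδ] with k hk r hr
  exact (h r (lt_of_le_of_lt hr hk)).le

lemma lim_U {U : ℝ → Ω → ℝ} (hcM : Continuous fun t => M t ω) (hcU : Continuous fun t => U t ω)
    (hρ0 : 0 ≤ ρ ω) {T : ℝ} (hρT : ρ ω ≤ T) {K : ℝ} (hK : ∀ r, |U r ω| ≤ K) {e : ℕ → ℝ} (he : ∀ k, 0 < e k)
    (het : Tendsto e atTop (𝓝 0))
    (hu : ∀ δ > 0, ∀ᶠ k in atTop, ∀ s ∈ Icc (0:ℝ) T, |ucpApproxQC U M (e k) s ω| < δ) :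
    Tendsto (fun k => ucpApproxQC U (stM M ρ) (e k) T ω) atTop (𝓝 0) := by
  rw [Metric.tendsto_nhds]
  intro δ hδ
  have hK0 : 0 ≤ K := (abs_nonneg _).trans (hK 0)
  have hη : 0 < δ / (4 * (K + 1)) := by positivity
  filter_upwards [hu (δ/2) (by positivity), ev_eta hcM (ρ ω) het hη] with k h1 h2
  have h3 := edge_U hcM hcU hρ0 hρT (he k) hK h2
  have h4 := h1 (ρ ω) ⟨hρ0, hρT⟩
  rw [Real.dist_eq, sub_zero]
  have h5 : 2 * K * (δ / (4 * (K+1))) < δ / 2 := by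
    rw [mul_div_assoc', div_lt_div_iff₀ (by positivity) (by positivity)]
    nlinarith
  have h6 := abs_sub_abs_le_abs_sub (ucpApproxQC U (stM M ρ) (e k) T ω) (ucpApproxQC U M (e k) (ρ ω) ω)
  linarith

lemma lim_N {Q : ℝ → Ω → ℝ} (hcM : Continuous fun t => M t ω)
    (hρ0 : 0 ≤ ρ ω) {T : ℝ} (hρT : ρ ω ≤ T) {mk : ℕ → ℕ} (he : ∀ k, 0 < T / mk k)
    (het : Tendsto (fun k => T / (mk k : ℝ)) atTop (𝓝 0)) (hQ : QGood M Q T mk ω) :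
    Tendsto (fun k => max (ucpApproxQC (stM M ρ) (stM M ρ) (T / mk k) T ω - Q T ω) 0) atTop (𝓝 0) := by
  rw [Metric.tendsto_nhds]
  intro δ hδ
  have hT : 0 ≤ T := hρ0.trans hρT
  have hη : 0 < min 1 (δ / 20) := by positivity
  filter_upwards [hQ.unif (δ/2) (by positivity), ev_eta hcM (ρ ω) het hη] with k h1 h2
  have h3 := (abs_le.1 (edge_N hcM hρ0 hρT (he k) h2)).2
  have h4 := (abs_lt.1 (h1 T ⟨hT, le_rfl⟩)).2
  have h5 := qc_self_mono hcM (he k) hρT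
  rw [Real.dist_eq, sub_zero, abs_of_nonneg (le_max_right _ _)]
  refine max_lt ?_ hδ
  have h6 : (min 1 (δ/20))^2 ≤ δ/20 := by
    have a1 := min_le_left 1 (δ/20)
    have a2 := min_le_right 1 (δ/20)
    nlinarith
  linarith
end


section
variable {P : Measure Ω} [IsProbabilityMeasure P]

lemma fatou_int {g : ℕ → Ω → ℝ} {f : Ω → ℝ} (hg : ∀ k, Integrable (g k) P) (hg0 : ∀ k, ∀ᵐ ω ∂P, 0 ≤ g k ω)
    {C : ℝ} (hC : ∀ k, ∫ ω, g k ω ∂P ≤ C) (hlim : ∀ᵐ ω ∂P, Tendsto (fun k => g k ω) atTop (𝓝 (f ω))) :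
    Integrable f P ∧ ∫ ω, f ω ∂P ≤ C := by
  have hC0 : 0 ≤ C := (integral_nonneg_of_ae (hg0 0)).trans (hC 0)
  have hm : AEStronglyMeasurable f P := aestronglyMeasurable_of_tendsto_ae atTop (fun k => (hg k).1) hlim
  have hf0 : ∀ᵐ ω ∂P, 0 ≤ f ω := by
    filter_upwards [hlim, ae_all_iff.2 hg0] with ω h1 h2
    exact ge_of_tendsto' h1 h2
  have hle : ∫⁻ ω, ENNReal.ofReal (f ω) ∂P ≤ ENNReal.ofReal C := by
    have e1 : ∫⁻ ω, ENNReal.ofReal (f ω) ∂P = ∫⁻ ω, liminf (fun k => ENNReal.ofReal (g k ω)) atTop ∂P := by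
      refine lintegral_congr_ae ?_
      filter_upwards [hlim] with ω h
      exact ((ENNReal.continuous_ofReal.tendsto _).comp h).liminf_eq.symm
    rw [e1]
    refine (lintegral_liminf_le' fun k => (hg k).1.aemeasurable.ennreal_ofReal).trans ?_
    refine (liminf_le_liminf (Eventually.of_forall fun k => ?_)
      (v := fun _ => ENNReal.ofReal C)).trans (by simp)
    rw [← ofReal_integral_eq_lintegral_ofReal (hg k) (hg0 k)]
    exact ENNReal.ofReal_le_ofReal (hC k)
  have hfi : Integrable f P := by
    refine ⟨hm, ?_⟩
    rw [hasFiniteIntegral_iff_ofReal hf0]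
    exact hle.trans_lt ENNReal.ofReal_lt_top
  refine ⟨hfi, ?_⟩
  rw [← ofReal_integral_eq_lintegral_ofReal hfi hf0] at hle
  exact (ENNReal.ofReal_le_ofReal_iff hC0).1 hle

lemma ce_selfadj {m : MeasurableSpace Ω} (hm : m ≤ m0) {f g : Ω → ℝ} (hf : Integrable f P) (hg : Integrable g P)
    (hb : ∀ ω, |f ω| ≤ 1) : ∫ ω, f ω * (P[g | m]) ω ∂P = ∫ ω, (P[f | m]) ω * g ω ∂P := by
  have hb2 : ∀ᵐ ω ∂P, ‖(P[f | m]) ω‖ ≤ (1:ℝ≥0) :=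
    ae_bdd_condExp_of_ae_bdd (R := 1) (Eventually.of_forall fun ω => by simpa using hb ω)
  have i1 : Integrable (f * P[g | m]) P := integrable_condExp.bdd_mul (c := 1) hf.1 (Eventually.of_forall hb)
  have i2 : Integrable (P[f | m] * g) P := hg.bdd_mul (c := 1) integrable_condExp.1 (by simpa using hb2)
  have h1 := condExp_mul_of_stronglyMeasurable_right (m := m) (stronglyMeasurable_condExp) i1 hf
  have h2 := condExp_mul_of_stronglyMeasurable_left (m := m) (stronglyMeasurable_condExp) i2 hg
  calc ∫ ω, f ω * (P[g | m]) ω ∂P = ∫ ω, (P[f * P[g | m] | m]) ω ∂P := (integral_condExp hm).symm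
    _ = ∫ ω, (P[P[f | m] * g | m]) ω ∂P := integral_congr_ae (h1.trans h2.symm)
    _ = _ := integral_condExp hm

variable {ℱ : Filtration ℝ m0} {X A M Mo σo Io QM QMo : ℝ → Ω → ℝ}

lemma gAll_le (hm : ∀ s, Measurable (Mo s)) : gSigmaAll Mo ≤ m0 :=
  iSup₂_le fun s _ => measurable_iff_comap_le.mp (hm s)

lemma g_le_all (r : ℝ) : gSigma Mo r ≤ gSigmaAll Mo :=
  iSup₂_le fun s hs => le_iSup₂_of_le s hs.1 le_rfl

lemma g_le_F (h : StronglyAdapted ℱ Mo) (r : ℝ) : gSigma Mo r ≤ ℱ r :=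
  iSup₂_le fun s hs => ((h s).measurable.comap_le).trans (ℱ.mono hs.2)

lemma H_C1 (hS : SettingNoStop P ℱ X A M Mo σo Io QM QMo) {r : ℝ} (hr : 0 ≤ r) {Z : Ω → ℝ} (hZ : Integrable Z P)
    (hZm : StronglyMeasurable[gSigmaAll Mo] Z) : P[Z | ℱ r] =ᵐ[P] P[Z | gSigma Mo r] := by
  have hmA := gAll_le hS.hMo_meas
  have hm1 := (g_le_all (Mo := Mo) r).trans hmA
  symm
  refine ae_eq_condExp_of_forall_setIntegral_eq (ℱ.le r) hZ (fun s _ _ => integrable_condExp.integrableOn)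
    ?_ (stronglyMeasurable_condExp.mono (g_le_F hS.hMo_mart.1 r)).aestronglyMeasurable
  intro D hD _
  have hDm := ℱ.le r D hD
  set f : Ω → ℝ := D.indicator (fun _ => (1:ℝ)) with hf
  have hfi : Integrable f P := (integrable_const 1).indicator hDm
  have hfb : ∀ ω, |f ω| ≤ 1 := fun ω => by
    by_cases h : ω ∈ D <;> simp [hf, h]
  have hind : ∀ g : Ω → ℝ, ∫ ω in D, g ω ∂P = ∫ ω, f ω * g ω ∂P := fun g => by
    rw [← integral_indicator hDm]
    congr 1; funext ω
    by_cases h : ω ∈ D <;> simp [hf, h]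
  rw [hind, hind, ce_selfadj hm1 hfi hZ hfb]
  have hH := hS.hH r hr D hD
  rw [integral_congr_ae (g := fun ω => (P[f | gSigmaAll Mo]) ω * Z ω)
    (by filter_upwards [hH] with ω h; rw [h]), ← ce_selfadj hmA hfi hZ hfb,
    condExp_of_stronglyMeasurable hmA hZm hZ]

lemma H_C2 (hS : SettingNoStop P ℱ X A M Mo σo Io QM QMo) {r : ℝ} (hr : 0 ≤ r) {f : Ω → ℝ} (hf : Integrable f P)
    (hfm : StronglyMeasurable[ℱ r] f) : P[f | gSigmaAll Mo] =ᵐ[P] P[f | gSigma Mo r] := by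
  have hmA := gAll_le hS.hMo_meas
  have hm1 := (g_le_all (Mo := Mo) r).trans hmA
  symm
  refine ae_eq_condExp_of_forall_setIntegral_eq hmA hf (fun s _ _ => integrable_condExp.integrableOn)
    ?_ (stronglyMeasurable_condExp.mono (g_le_all r)).aestronglyMeasurable
  intro B hB _
  have hBm := hmA B hB
  set b : Ω → ℝ := B.indicator (fun _ => (1:ℝ)) with hb
  have hbi : Integrable b P := (integrable_const 1).indicator hBm
  have hbb : ∀ ω, |b ω| ≤ 1 := fun ω => by
    by_cases h : ω ∈ B <;> simp [hb, h]
  have hind : ∀ g : Ω → ℝ, ∫ ω in B, g ω ∂P = ∫ ω, b ω * g ω ∂P := fun g => by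
    rw [← integral_indicator hBm]
    congr 1; funext ω
    by_cases h : ω ∈ B <;> simp [hb, h]
  rw [hind, hind, ce_selfadj hm1 hbi hf hbb]
  have hc := H_C1 hS hr hbi (stronglyMeasurable_const.indicator hB)
  rw [integral_congr_ae (g := fun ω => (P[b | ℱ r]) ω * f ω)
    (by filter_upwards [hc] with ω h; rw [h]), ← ce_selfadj (ℱ.le r) hbi hf hbb,
    condExp_of_stronglyMeasurable (ℱ.le r) hfm hf]

lemma stM_sq_le (hS : SettingNoStop P ℱ X A M Mo σo Io QM QMo) {T : ℝ} (hT : 0 < T) {n : ℝ} (hn : 0 ≤ n)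
    {ρ : Ω → ℝ} (hρ : RS ℱ ρ) (hρ0 : ∀ ω, 0 ≤ ρ ω) (hρl : ∀ ω, ρ ω ≤ hit M T n ω) :
    ∫ ω, (stM M ρ T ω)^2 ∂P ≤ ∫ ω, QM T ω ∂P := by
  have hB := hit_BM hS.hM_mart hS.hM_cont hS.hM0 hT.le hn hρ hρ0 hρl
  obtain ⟨mk, h0, hmt, hae⟩ := qgood_ae hS.hM_cont hS.hQM hT
  have hε : ∀ k, 0 < T / mk k := fun k => by have := h0 k; positivity
  have hεt : Tendsto (fun k => T / (mk k : ℝ)) atTop (𝓝 0) :=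
    tendsto_const_nhds.div_atTop (tendsto_natCast_atTop_atTop.comp hmt)
  have := prod_lemma hB hB hT mk h0 hmt (QM T) (qm_integrable hS hT.le)
    (by filter_upwards [hae] with ω h using h.nonneg ⟨hT.le, le_rfl⟩)
    (by filter_upwards [hae] with ω h
        exact lim_N (hS.hM_cont ω) (hρ0 ω) ((hρl ω).trans (hit_leT hT.le n ω)) hε hεt h)
  have hz : ∀ ω, stM M ρ 0 ω = 0 := fun ω => by
    rw [stM_lt le_rfl (hρ0 ω)]; exact hS.hM0 ω
  simp only [hz, mul_zero, integral_zero, sub_zero, ← sq, ne_eq, OfNat.ofNat_ne_zero, not_false_eq_true, zero_pow] at this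
  exact this

lemma M_sq (hS : SettingNoStop P ℱ X A M Mo σo Io QM QMo) {T : ℝ} (hT : 0 < T) :
    Integrable (fun ω => (M T ω)^2) P ∧ ∫ ω, (M T ω)^2 ∂P ≤ ∫ ω, QM T ω ∂P := by
  have hRS : ∀ n : ℕ, RS ℱ (hit M T n) := fun n => hit_RS hS.hM_mart.1 hS.hM_cont hT.le n
  have h0 : ∀ n : ℕ, ∀ ω, 0 ≤ hit M T n ω := fun n => hit_nonneg hS.hM_cont hT.le n
  refine fatou_int (g := fun (n:ℕ) ω => (stM M (hit M T n) T ω)^2) (fun n => ?_)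
    (fun n => Eventually.of_forall fun ω => sq_nonneg _)
    (fun n => stM_sq_le hS hT (Nat.cast_nonneg n) (hRS n) (h0 n) (fun ω => le_rfl)) ?_
  · have hB := hit_BM hS.hM_mart hS.hM_cont hS.hM0 hT.le (Nat.cast_nonneg n) (hRS n) (h0 n) (fun ω => le_rfl)
    refine hlp_int_bdd ((hB.meas T).pow_const 2) (n^2) fun ω => ?_
    rw [abs_pow]; exact pow_le_pow_left₀ (abs_nonneg _) (hB.bdd T ω) 2
  · refine Eventually.of_forall fun ω => ?_
    refine tendsto_const_nhds.congr' ?_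
    filter_upwards [hit_ev hS.hM_cont hT.le ω] with n hn
    rw [stM_gt hT.le hn.le, hn]
end


section
variable {P : Measure Ω} [IsProbabilityMeasure P]

def clampN (n x : ℝ) : ℝ := max (-n) (min x n)

lemma clampN_cont (n : ℝ) : Continuous (clampN n) := by unfold clampN; fun_prop

lemma clampN_bdd {n : ℝ} (hn : 0 ≤ n) (x : ℝ) : |clampN n x| ≤ n := by
  unfold clampN
  rw [abs_le]
  exact ⟨le_max_left _ _, max_le (by linarith) (min_le_right _ _)⟩

lemma clampN_eq {n x : ℝ} (h : |x| ≤ n) : clampN n x = x := by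
  rw [abs_le] at h
  unfold clampN
  rw [min_eq_left h.2, max_eq_right h.1]

def pathC (N : ℝ → Ω → ℝ) (hc : ∀ ω, Continuous fun t => N t ω) (T : ℝ) (ω : Ω) : C(unitInterval, ℝ) :=
  ⟨fun x => N (T * x) ω, (hc ω).comp (by fun_prop)⟩

lemma pathC_sm (N : ℝ → Ω → ℝ) (hc : ∀ ω, Continuous fun t => N t ω) (hm : ∀ r, Measurable (N r)) (T : ℝ) :
    StronglyMeasurable (pathC N hc T) := by
  refine stronglyMeasurable_of_tendsto atTop (f := fun k ω => bernsteinApproximation k (pathC N hc T ω)) ?_ ?_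
  · intro k
    unfold bernsteinApproximation
    refine Finset.stronglyMeasurable_fun_sum _ fun i _ => ?_
    have h1 : Continuous fun y : ℝ => (bernstein k i • ContinuousMap.const unitInterval y : C(unitInterval, ℝ)) := by
      have e : (fun y : ℝ => (bernstein k i • ContinuousMap.const unitInterval y : C(unitInterval, ℝ))) =
          fun y : ℝ => bernstein k i * ContinuousMap.const unitInterval y := by
        funext y; ext x; simp
      rw [e]
      refine continuous_const.mul ?_
      exact ContinuousMap.continuous_const' (X := unitInterval) (Y := ℝ)
    exact h1.comp_stronglyMeasurable (hm _).stronglyMeasurable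
  · rw [tendsto_pi_nhds]
    intro ω
    exact bernsteinApproximation_uniform _

lemma cond_path (N : ℝ → Ω → ℝ) (hc : ∀ ω, Continuous fun t => N t ω) (hm : ∀ r, Measurable (N r))
    {n : ℝ} (hn : 0 ≤ n) (hb : ∀ r ω, |N r ω| ≤ n) {T : ℝ} (hT : 0 < T) {G : MeasurableSpace Ω} (hG : G ≤ m0) :
    ∃ V : ℝ → Ω → ℝ, (∀ ω, Continuous fun t => V t ω) ∧ (∀ r, StronglyMeasurable[G] (V r)) ∧
      (∀ r ω, |V r ω| ≤ n) ∧ (∀ r ∈ Icc 0 T, V r =ᵐ[P] P[N r | G]) ∧ (∀ r, T ≤ r → V r = V T) ∧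
      (∀ r, r ≤ 0 → V r = V 0) := by
  set Φ := pathC N hc T with hΦ
  have hint : Integrable Φ P := by
    refine Integrable.of_bound (pathC_sm N hc hm T).aestronglyMeasurable n (Eventually.of_forall fun ω => ?_)
    rw [ContinuousMap.norm_le _ hn]
    intro x
    exact hb _ ω
  set pr : ℝ → unitInterval := fun r => projIcc 0 1 zero_le_one (r / T) with hpr
  refine ⟨fun r ω => clampN n ((P[Φ | G]) ω (pr r)), ?_, ?_, ?_, ?_, ?_, ?_⟩
  · intro ω
    refine (clampN_cont n).comp ?_
    refine ((P[Φ | G]) ω).continuous.comp ?_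
    exact continuous_projIcc.comp (by fun_prop)
  · intro r
    have h1 : Continuous fun f : C(unitInterval, ℝ) => clampN n (f (pr r)) :=
      (clampN_cont n).comp (continuous_eval_const (pr r))
    exact h1.comp_stronglyMeasurable stronglyMeasurable_condExp
  · intro r ω; exact clampN_bdd hn _
  · intro r hr
    have hp : T * (pr r : ℝ) = r := by
      rw [hpr]
      simp only
      rw [projIcc_of_mem zero_le_one (⟨by have := hr.1; positivity, by rw [div_le_one hT]; exact hr.2⟩ : r / T ∈ Icc (0:ℝ) 1)]
      field_simp
    have h := (ContinuousMap.evalCLM ℝ (pr r) : C(unitInterval, ℝ) →L[ℝ] ℝ).comp_condExp_comm (m := G) hint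
    have hcomp : (⇑(ContinuousMap.evalCLM ℝ (pr r) : C(unitInterval, ℝ) →L[ℝ] ℝ) ∘ Φ) = N r := by
      funext ω
      simp [hΦ, pathC, hp]
    rw [hcomp] at h
    have hb2 : ∀ᵐ ω ∂P, |(P[N r | G]) ω| ≤ n :=
      ae_bdd_abs_condExp_of_ae_bdd_abs (Eventually.of_forall (hb r))
    filter_upwards [h, hb2] with ω h1 h2
    have h3 : (P[Φ | G]) ω (pr r) = (P[N r | G]) ω := by
      rw [← h1]; simp
    rw [h3]
    exact clampN_eq h2
  · intro r hr
    have : pr r = pr T := by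
      simp only [hpr]
      rw [projIcc_of_right_le _ (by rw [le_div_iff₀ hT]; linarith), div_self hT.ne', projIcc_right]
    funext ω
    simp only [this]
  · intro r hr
    have : pr r = pr 0 := by
      simp only [hpr]
      rw [projIcc_of_le_left _ (by rw [div_le_iff₀ hT]; linarith), zero_div, projIcc_left]
    funext ω
    simp only [this]
end


section
variable {P : Measure Ω} [IsProbabilityMeasure P]
variable {ℱ : Filtration ℝ m0} {X A M Mo σo Io QM QMo : ℝ → Ω → ℝ}

lemma dy_tendsto (r : ℝ) : Tendsto (fun k : ℕ => (⌊(k+1:ℝ) * r⌋ : ℝ) / (k+1)) atTop (𝓝 r) := by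
  have h2 : Tendsto (fun k : ℕ => r - 1 / ((k:ℝ)+1)) atTop (𝓝 (r - 0)) :=
    tendsto_const_nhds.sub tendsto_one_div_add_atTop_nhds_zero_nat
  rw [sub_zero] at h2
  refine tendsto_of_tendsto_of_tendsto_of_le_of_le h2 tendsto_const_nhds ?_ ?_
  · intro k
    have hk : (0:ℝ) < k + 1 := by positivity
    simp only
    have hx : (r - 1 / ((k:ℝ)+1)) * (k+1) = (k+1) * r - 1 := by field_simp
    rw [le_div_iff₀ hk, hx]
    exact (Int.sub_one_lt_floor _).le
  · intro k
    have hk : (0:ℝ) < k + 1 := by positivity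
    simp only
    rw [div_le_iff₀ hk, mul_comm r]; exact Int.floor_le _

lemma dy_le (r : ℝ) (k : ℕ) : (⌊(k+1:ℝ) * r⌋ : ℝ) / (k+1) ≤ r := by
  have hk : (0:ℝ) < k + 1 := by positivity
  rw [div_le_iff₀ hk, mul_comm r]; exact Int.floor_le _

lemma step1 (hS : SettingNoStop P ℱ X A M Mo σo Io QM QMo) {T : ℝ} (hT : 0 < T) {n : ℝ} (hn : 0 ≤ n)
    {ρ : Ω → ℝ} (hρ : RS ℱ ρ) (hρ0 : ∀ ω, 0 ≤ ρ ω) (hρl : ∀ ω, ρ ω ≤ hit M T n ω) :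
    P[stM M ρ T | gSigmaAll Mo] =ᵐ[P] 0 := by
  have hB := hit_BM hS.hM_mart hS.hM_cont hS.hM0 hT.le hn hρ hρ0 hρl
  have hρT : ∀ ω, ρ ω ≤ T := fun ω => (hρl ω).trans (hit_leT hT.le n ω)
  have hmA := gAll_le hS.hMo_meas
  set N := stM M ρ with hN
  have hNi : ∀ r, Integrable (N r) P := fun r => hlp_int_bdd (hB.meas r) n (hB.bdd r)
  have hNsm : ∀ r, 0 ≤ r → StronglyMeasurable[ℱ r] (N r) := fun r hr => stM_sm hS.hM_mart hS.hM_cont hρ hr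
  have hN0 : ∀ r, r ≤ 0 → N r = 0 := fun r hr => by
    funext ω
    simp only [hN, stM, max_eq_right hr, min_eq_right (hρ0 ω)]
    exact hS.hM0 ω
  have hNmax : ∀ r, N r = N (max r 0) := fun r => by
    funext ω; simp [hN, stM]
  have hNT : ∀ r, T ≤ r → N r = N T := fun r hr => by
    funext ω
    rw [hN, stM_gt (hT.le.trans hr) ((hρT ω).trans hr), stM_gt hT.le (hρT ω)]
  obtain ⟨V, hVc, hVm, hVb, hVe, hVT, hV0⟩ := cond_path (P := P) N hB.cont hB.meas hn hB.bdd hT hmA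
  have hVi : ∀ r, Integrable (V r) P := fun r => hlp_int_bdd ((hVm r).mono hmA).measurable n (hVb r)
  -- V r is cond exp given the full sigma field, all r
  have hVA : ∀ r, V r =ᵐ[P] P[N r | gSigmaAll Mo] := by
    intro r
    rcases le_total r 0 with h | h
    · rw [hV0 r h, hN0 r h]
      have := hVe 0 ⟨le_rfl, hT.le⟩
      rwa [hN0 0 le_rfl] at this
    rcases le_total r T with h' | h'
    · exact hVe r ⟨h, h'⟩
    · rw [hVT r h', hNT r h']; exact hVe T ⟨hT.le, le_rfl⟩
  have hVg : ∀ r, V r =ᵐ[P] P[N r | gSigma Mo r] := by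
    intro r
    rcases lt_or_ge r 0 with h | h
    · refine (hVA r).trans ?_
      rw [hN0 r h.le, condExp_zero, condExp_zero]
    · exact (hVA r).trans (H_C2 hS h (hNi r) (hNsm r h))
  have hgle : ∀ r, gSigma Mo r ≤ m0 := fun r => (g_le_all (Mo := Mo) r).trans hmA
  have hgmono : ∀ {i j : ℝ}, i ≤ j → gSigma Mo i ≤ gSigma Mo j := fun {i j} h =>
    (gFilt Mo hS.hMo_meas).mono h
  have hNg : ∀ i j, i ≤ j → P[N j | gSigma Mo i] =ᵐ[P] P[N i | gSigma Mo i] := by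
    intro i j hij
    have h1 : gSigma Mo i ≤ ℱ (max i 0) :=
      (hgmono (le_max_left i 0)).trans (g_le_F hS.hMo_mart.1 _)
    have h2 := condExp_condExp_of_le (μ := P) (f := N j) h1 (ℱ.le _)
    refine h2.symm.trans (condExp_congr_ae ?_)
    rw [hNmax j, hNmax i]
    exact hB.ce _ _ (le_max_right _ _) (max_le_max_right 0 hij)
  -- V is a bounded martingale for the big filtration
  have hVBM : BM P ℱ n V := by
    refine ⟨hVc, fun r => ((hVm r).mono hmA).measurable, hVb, ?_⟩
    intro r u hr hru
    calc P[V u | ℱ r] =ᵐ[P] P[V u | gSigma Mo r] := H_C1 hS hr (hVi u) (hVm u)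
      _ =ᵐ[P] P[P[N u | gSigmaAll Mo] | gSigma Mo r] := condExp_congr_ae (hVA u)
      _ =ᵐ[P] P[N u | gSigma Mo r] := condExp_condExp_of_le (g_le_all r) hmA
      _ =ᵐ[P] P[N r | gSigma Mo r] := hNg r u hru
      _ =ᵐ[P] V r := (hVg r).symm
  -- raw adapted version
  set u : ℝ → Ω → ℝ := fun q => P[N q | gSigma Mo q] with hu
  set d : ℕ → ℝ → ℝ := fun k r => (⌊(k+1:ℝ) * r⌋ : ℝ) / (k+1) with hd
  set U : ℝ → Ω → ℝ := fun r ω => limsup (fun k => u (d k r) ω) atTop with hU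
  have hUV : ∀ᵐ ω ∂P, ∀ r, U r ω = V r ω := by
    have : ∀ᵐ ω ∂P, ∀ p : ℕ × ℤ, V ((p.2 : ℝ) / (p.1 + 1)) ω = u ((p.2 : ℝ) / (p.1 + 1)) ω :=
      ae_all_iff.2 fun p => hVg _
    filter_upwards [this] with ω h r
    have h1 : ∀ k, u (d k r) ω = V (d k r) ω := fun k => (h (k, ⌊(k+1:ℝ) * r⌋)).symm
    simp only [hU, h1]
    exact (((hVc ω).tendsto r).comp (dy_tendsto r)).limsup_eq
  have hUVr : ∀ r, U r =ᵐ[P] V r := fun r => by filter_upwards [hUV] with ω h using h r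
  have hUad : ∀ r, StronglyMeasurable[gSigma Mo r] (U r) := by
    intro r
    refine Measurable.stronglyMeasurable ?_
    refine Measurable.limsup fun k => ?_
    exact (stronglyMeasurable_condExp.mono (hgmono (dy_le r k))).measurable
  have hUm : Martingale U (gFilt Mo hS.hMo_meas) P := by
    refine ⟨hUad, fun i j hij => ?_⟩
    calc P[U j | gSigma Mo i] =ᵐ[P] P[P[N j | gSigma Mo j] | gSigma Mo i] :=
          condExp_congr_ae ((hUVr j).trans (hVg j))
      _ =ᵐ[P] P[N j | gSigma Mo i] := condExp_condExp_of_le (hgmono hij) (hgle j)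
      _ =ᵐ[P] P[N i | gSigma Mo i] := hNg i j hij
      _ =ᵐ[P] U i := ((hUVr i).trans (hVg i)).symm
  have hUc : ∀ᵐ ω ∂P, IsCadlagFn fun t => U t ω := by
    filter_upwards [hUV] with ω h t
    have : (fun t => U t ω) = fun t => V t ω := funext h
    rw [this]
    exact ⟨(hVc ω).continuousWithinAt, _, (hVc ω).continuousWithinAt⟩
  have horth := hS.hM_orth U hUm hUc 1
  obtain ⟨mk, h0, hmt, hae⟩ := ucp_subseq horth hT
  have hε : ∀ k, 0 < T / mk k := fun k => by have := h0 k; positivity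
  have hεt : Tendsto (fun k => T / (mk k : ℝ)) atTop (𝓝 0) :=
    tendsto_const_nhds.div_atTop (tendsto_natCast_atTop_atTop.comp hmt)
  have hp := prod_lemma hVBM hB hT mk h0 hmt 0 (integrable_zero _ _ _) (Eventually.of_forall fun _ => le_rfl)
    (by filter_upwards [hae, hUV] with ω h hv
        have := lim_U (M := M) (ρ := ρ) (ω := ω) (hS.hM_cont ω) (hVc ω) (hρ0 ω) (hρT ω) (fun r => hVb r ω) hε hεt (by
          intro δ hδ
          filter_upwards [h δ hδ] with k hk s hs
          have := hk s hs
          have e : ucpApproxQC (fun t ω => ⟪M t ω, (1:ℝ)⟫) U (T / mk k) s ω = ucpApproxQC V M (T / mk k) s ω := by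
            unfold ucpApproxQC
            simp only [hv]
            congr 1
            refine integral_congr_ae (Eventually.of_forall fun r => ?_)
            simp [mul_comm]
          rw [e] at this
          simpa using this)
        have h2 := (this.sub_const 0).max (tendsto_const_nhds (x := (0:ℝ)))
        simpa using h2)
  have hz : ∀ ω, N 0 ω = 0 := fun ω => by rw [hN0 0 le_rfl]; rfl
  simp only [hz, mul_zero, integral_zero, sub_zero, Pi.zero_apply] at hp
  have hVTT := hVe T ⟨hT.le, le_rfl⟩
  have hVb' : ∀ᵐ ω ∂P, ‖V T ω‖ ≤ n := Eventually.of_forall (hVb T)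
  have i1 : Integrable (V T * N T) P := (hNi T).bdd_mul (c := n) (hVi T).1 hVb'
  have i2 : Integrable (fun ω => V T ω * V T ω) P := (hVi T).bdd_mul (c := n) (hVi T).1 hVb'
  have hce := condExp_mul_of_stronglyMeasurable_left (m := gSigmaAll Mo) (μ := P) (hVm T) i1 (hNi T)
  have e1 : ∫ ω, V T ω * N T ω ∂P = ∫ ω, V T ω * V T ω ∂P := by
    calc ∫ ω, V T ω * N T ω ∂P = ∫ ω, (P[V T * N T | gSigmaAll Mo]) ω ∂P := (integral_condExp hmA).symm
      _ = _ := integral_congr_ae (by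
        filter_upwards [hce, hVTT] with ω h1 h2
        rw [h1, Pi.mul_apply, ← h2])
  rw [e1] at hp
  have hz2 : (fun ω => V T ω * V T ω) =ᵐ[P] 0 :=
    (integral_eq_zero_iff_of_nonneg (fun ω => mul_self_nonneg _) i2).1
      (le_antisymm hp (integral_nonneg fun ω => mul_self_nonneg _))
  filter_upwards [hz2, hVTT] with ω h1 h2
  rw [← h2]
  exact mul_self_eq_zero.1 h1
end


section
variable {P : Measure Ω} [IsProbabilityMeasure P]
variable {ℱ : Filtration ℝ m0} {X A M Mo σo Io QM QMo : ℝ → Ω → ℝ}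

lemma M_sqi (hS : SettingNoStop P ℱ X A M Mo σo Io QM QMo) {s : ℝ} (hs : 0 ≤ s) :
    Integrable (fun ω => (M s ω)^2) P := by
  rcases hs.eq_or_lt with h | h
  · subst h
    simp [hS.hM0]
  · exact (M_sq hS h).1

lemma M_sm (hS : SettingNoStop P ℱ X A M Mo σo Io QM QMo) (s : ℝ) : StronglyMeasurable (M s) :=
  (hS.hM_mart.1 s).mono (ℱ.le s)

lemma M_L2 (hS : SettingNoStop P ℱ X A M Mo σo Io QM QMo) {s : ℝ} (hs : 0 ≤ s) : MemLp (M s) 2 P :=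
  (memLp_two_iff_integrable_sq (M_sm hS s).aestronglyMeasurable).2 (M_sqi hS hs)

lemma lim_zero (hS : SettingNoStop P ℱ X A M Mo σo Io QM QMo) {T : ℝ} (hT : 0 < T)
    (ρ : ℕ → Ω → ℝ) (hρ : ∀ n, RS ℱ (ρ n)) (hρ0 : ∀ n ω, 0 ≤ ρ n ω) (hρl : ∀ (n : ℕ) ω, ρ n ω ≤ hit M T n ω)
    (Z : Ω → ℝ) (hZ : MemLp Z 2 P) (hev : ∀ ω, ∀ᶠ n in atTop, stM M (ρ n) T ω = Z ω) {B : Set Ω}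
    (hB : MeasurableSet[gSigmaAll Mo] B) : ∫ ω in B, Z ω ∂P = 0 := by
  have hmA := gAll_le hS.hMo_meas
  have hBm := hmA B hB
  have hBM : ∀ n : ℕ, BM P ℱ n (stM M (ρ n)) := fun n =>
    hit_BM hS.hM_mart hS.hM_cont hS.hM0 hT.le (Nat.cast_nonneg n) (hρ n) (hρ0 n) (hρl n)
  have hi : ∀ n, Integrable (stM M (ρ n) T) P := fun n => hlp_int_bdd ((hBM n).meas T) n ((hBM n).bdd T)
  have hL : ∀ n, MemLp (stM M (ρ n) T) 2 P := fun n =>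
    MemLp.of_bound ((hBM n).meas T).aestronglyMeasurable n (Eventually.of_forall ((hBM n).bdd T))
  have hZi : Integrable Z P := hZ.integrable one_le_two
  have hz : ∀ n, ∫ ω in B, stM M (ρ n) T ω ∂P = 0 := fun n => by
    rw [← setIntegral_condExp hmA (hi n) hB]
    have := step1 hS hT (Nat.cast_nonneg n) (hρ n) (hρ0 n) (hρl n)
    rw [setIntegral_congr_ae hBm (g := fun _ => (0:ℝ)) (by filter_upwards [this] with ω h _ using h)]
    simp
  have ht := hlp_L2_tendsto P (fun n ω => stM M (ρ n) T ω - Z ω) (fun n => ((hL n).sub hZ).1)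
    (fun n => ((hL n).sub hZ).integrable_sq) (2 * ∫ ω, QM T ω ∂P + 2 * ∫ ω, (Z ω)^2 ∂P)
    (fun n => by
      have a1 := (hL n).integrable_sq
      have a2 := hZ.integrable_sq
      have h1 : ∫ ω, (stM M (ρ n) T ω - Z ω)^2 ∂P ≤ ∫ ω, (2 * (stM M (ρ n) T ω)^2 + 2 * (Z ω)^2) ∂P :=
        integral_mono ((hL n).sub hZ).integrable_sq ((a1.const_mul 2).add (a2.const_mul 2)) fun ω => by
          simp only [Pi.sub_apply]
          nlinarith [sq_nonneg (stM M (ρ n) T ω + Z ω)]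
      rw [integral_add (a1.const_mul 2) (a2.const_mul 2), integral_const_mul, integral_const_mul] at h1
      have := stM_sq_le hS hT (Nat.cast_nonneg n) (hρ n) (hρ0 n) (hρl n)
      linarith)
    (Eventually.of_forall fun ω => by
      refine tendsto_const_nhds.congr' ?_
      filter_upwards [hev ω] with n h
      rw [h, sub_self])
  have hle : ∀ n, |∫ ω in B, Z ω ∂P| ≤ ∫ ω, |stM M (ρ n) T ω - Z ω| ∂P := fun n => by
    have e : ∫ ω in B, (stM M (ρ n) T ω - Z ω) ∂P = - ∫ ω in B, Z ω ∂P := by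
      rw [integral_sub (hi n).integrableOn hZi.integrableOn, hz n, zero_sub]
    rw [← abs_neg, ← e]
    refine (abs_integral_le_integral_abs).trans ?_
    exact setIntegral_le_integral ((hi n).sub hZi).abs (Eventually.of_forall fun ω => abs_nonneg _)
  have := ge_of_tendsto' ht hle
  exact abs_eq_zero.1 (le_antisymm this (abs_nonneg _))

lemma DB_zero (hS : SettingNoStop P ℱ X A M Mo σo Io QM QMo) {s t : ℝ} (hs : 0 ≤ s) (hst : s ≤ t) (ht : 0 < t)
    {B D : Set Ω} (hB : MeasurableSet[gSigmaAll Mo] B) (hD : MeasurableSet[ℱ s] D) :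
    ∫ ω in D, B.indicator (fun ω => M t ω - M s ω) ω ∂P = 0 := by
  classical
  have hmA := gAll_le hS.hMo_meas
  have hBm := hmA B hB
  have hDm := ℱ.le s D hD
  have hRS : ∀ n : ℕ, RS ℱ (hit M t n) := fun n => hit_RS hS.hM_mart.1 hS.hM_cont ht.le n
  have h0 : ∀ n : ℕ, ∀ ω, 0 ≤ hit M t n ω := fun n => hit_nonneg hS.hM_cont ht.le n
  have z1 := lim_zero hS ht (fun n : ℕ => hit M t n) hRS h0 (fun n ω => le_rfl) (M t) (M_L2 hS ht.le)
    (fun ω => by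
      filter_upwards [hit_ev hS.hM_cont ht.le ω] with n hn
      rw [stM_gt ht.le hn.le, hn]) hB
  set Z : Ω → ℝ := fun ω => M t ω - D.indicator (fun ω => M t ω - M s ω) ω with hZ
  have hdL : MemLp (fun ω => M t ω - M s ω) 2 P := (M_L2 hS ht.le).sub (M_L2 hS hs)
  have hZL : MemLp Z 2 P := (M_L2 hS ht.le).sub (hdL.indicator hDm)
  set σ : ℕ → Ω → ℝ := fun n ω => if ω ∈ D then min (hit M t n ω) s else hit M t n ω with hσ
  have hσRS : ∀ n, RS ℱ (σ n) := by
    intro n q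
    have : {ω | σ n ω ≤ q} = {ω | hit M t n ω ≤ q} ∪ (D ∩ {ω | s ≤ q}) := by
      ext ω
      by_cases h : ω ∈ D
      · simp only [hσ, h, if_true, Set.mem_ofPred_eq, min_le_iff, Set.mem_union, Set.mem_inter_iff, true_and]
      · simp only [hσ, h, if_false, Set.mem_ofPred_eq, Set.mem_union, Set.mem_inter_iff, false_and, or_false]
    rw [this]
    refine (hRS n q).union ?_
    by_cases h : s ≤ q
    · have : D ∩ {ω | s ≤ q} = D := by ext ω; simp [h]
      rw [this]; exact ℱ.mono h _ hD
    · have : D ∩ {ω | s ≤ q} = ∅ := by ext ω; simp [h]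
      rw [this]; exact @MeasurableSet.empty _ (ℱ q)
  have hσle : ∀ (n : ℕ) ω, σ n ω ≤ hit M t n ω := fun n ω => by
    simp only [hσ]; split_ifs
    · exact min_le_left _ _
    · exact le_rfl
  have z2 := lim_zero hS ht σ hσRS (fun n ω => by
      simp only [hσ]; split_ifs
      · exact le_min (h0 n ω) hs
      · exact h0 n ω) hσle Z hZL
    (fun ω => by
      filter_upwards [hit_ev hS.hM_cont ht.le ω] with n hn
      rw [stM_gt ht.le ((hσle n ω).trans hn.le)]
      by_cases h : ω ∈ D
      · simp [hσ, hZ, h, hn, min_eq_right hst]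
      · simp [hσ, hZ, h, hn]) hB
  have hdi : Integrable (fun ω => M t ω - M s ω) P := hdL.integrable one_le_two
  have i1 : Integrable (D.indicator (fun ω => M t ω - M s ω)) P := hdi.indicator hDm
  simp only [hZ] at z2
  rw [integral_sub ((M_L2 hS ht.le).integrable one_le_two).integrableOn i1.integrableOn, z1, zero_sub, neg_eq_zero,
    setIntegral_indicator hDm] at z2
  rw [setIntegral_indicator hBm, Set.inter_comm]
  exact z2

lemma incr (hS : SettingNoStop P ℱ X A M Mo σo Io QM QMo) {s t : ℝ} (hs : 0 ≤ s) (hst : s ≤ t)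
    {B : Set Ω} (hB : MeasurableSet[gSigmaAll Mo] B) :
    ∫ ω in B, (M t ω - M s ω)^2 ∂P = ∫ ω in B, (M t ω)^2 ∂P - ∫ ω in B, (M s ω)^2 ∂P := by
  have ht0 := hs.trans hst
  rcases ht0.eq_or_lt with h | ht
  · have hs' : s = 0 := by linarith
    subst hs'; rw [← h]; simp
  have hmA := gAll_le hS.hMo_meas
  have hBm := hmA B hB
  set h : Ω → ℝ := B.indicator (fun ω => M t ω - M s ω) with hh
  have hdL : MemLp (fun ω => M t ω - M s ω) 2 P := (M_L2 hS ht.le).sub (M_L2 hS hs)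
  have hhL : MemLp h 2 P := hdL.indicator hBm
  have hhi := hhL.integrable one_le_two
  have hce : P[h | ℱ s] =ᵐ[P] 0 := by
    symm
    refine ae_eq_condExp_of_forall_setIntegral_eq (ℱ.le s) hhi (fun _ _ _ => (integrable_zero _ _ _).integrableOn)
      ?_ stronglyMeasurable_zero.aestronglyMeasurable
    intro D hD _
    rw [DB_zero hS hs hst ht hB hD]; simp
  have hi : Integrable (M s * h) P := (M_L2 hS hs).integrable_mul hhL
  have hm := condExp_mul_of_stronglyMeasurable_left (m := ℱ s) (μ := P) (hS.hM_mart.1 s) hi hhi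
  have hz : ∫ ω, M s ω * h ω ∂P = 0 := by
    calc ∫ ω, M s ω * h ω ∂P = ∫ ω, (P[M s * h | ℱ s]) ω ∂P := (integral_condExp (ℱ.le s)).symm
      _ = ∫ ω, 0 ∂P := integral_congr_ae (by
        filter_upwards [hm, hce] with ω h1 h2
        rw [h1, Pi.mul_apply, h2]; simp)
      _ = 0 := integral_zero _ _
  have hz2 : ∫ ω in B, M s ω * (M t ω - M s ω) ∂P = 0 := by
    rw [← hz, ← integral_indicator hBm]
    congr 1; funext ω
    by_cases hω : ω ∈ B <;> simp [hh, hω]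
  have i0 : Integrable (fun ω => M s ω * (M t ω - M s ω)) P := (M_L2 hS hs).integrable_mul hdL
  have i1 := hdL.integrable_sq
  have e : ∀ ω, (M t ω)^2 = ((M t ω - M s ω)^2 + 2 * (M s ω * (M t ω - M s ω))) + (M s ω)^2 := fun ω => by ring
  have i2 : Integrable (fun ω => (M t ω - M s ω)^2 + 2 * (M s ω * (M t ω - M s ω))) P := i1.add (i0.const_mul 2)
  rw [integral_congr_ae (μ := P.restrict B) (Eventually.of_forall e),
    integral_add i2.integrableOn (M_sqi hS hs).integrableOn,
    integral_add i1.integrableOn (i0.const_mul 2).integrableOn, integral_const_mul, hz2]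
  ring
end


section
lemma mono_shift {φ : ℝ → ℝ} (hφ : Monotone φ) (h0 : ∀ r, 0 ≤ φ r) {a ε : ℝ} (ha : 0 ≤ a) (hε : 0 < ε) :
    ∫ r in Ioc (0:ℝ) a, (φ (r + ε) - φ r) ≤ ε * φ (a + ε) := by
  have hi : ∀ x y, IntervalIntegrable φ volume x y := fun x y => hφ.intervalIntegrable
  have hφ2 : Monotone fun r => φ (r + ε) := fun x y h => hφ (by linarith)
  rw [← intervalIntegral.integral_of_le ha, intervalIntegral.integral_sub hφ2.intervalIntegrable (hi _ _),
    intervalIntegral.integral_comp_add_right φ ε]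
  have e1 := intervalIntegral.integral_add_adjacent_intervals (hi 0 ε) (hi ε (a + ε))
  have e2 := intervalIntegral.integral_add_adjacent_intervals (hi 0 a) (hi a (a + ε))
  have e3 : 0 ≤ ∫ r in (0:ℝ)..ε, φ r := intervalIntegral.integral_nonneg hε.le fun r _ => h0 r
  have e4 : ∫ r in a..(a + ε), φ r ≤ ∫ r in a..(a + ε), φ (a + ε) :=
    intervalIntegral.integral_mono_on (by linarith) (hi _ _) intervalIntegrable_const fun r hr => hφ hr.2
  rw [intervalIntegral.integral_const, smul_eq_mul] at e4
  rw [zero_add]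
  have : a + ε - a = ε := by ring
  rw [this] at e4
  linarith

variable {P : Measure Ω} [IsProbabilityMeasure P]
variable {ℱ : Filtration ℝ m0} {X A M Mo σo Io QM QMo : ℝ → Ω → ℝ}

lemma qc_B (hS : SettingNoStop P ℱ X A M Mo σo Io QM QMo) {a ε : ℝ} (ha : 0 ≤ a) (hε : 0 < ε) {B : Set Ω}
    (hB : MeasurableSet[gSigmaAll Mo] B) :
    IntegrableOn (ucpApproxQC M M ε a) B P ∧ ∫ ω in B, ucpApproxQC M M ε a ω ∂P ≤ ∫ ω in B, (M (a + ε) ω)^2 ∂P := by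
  set ψ : ℝ → ℝ := fun r => ∫ ω in B, (M (max r 0) ω)^2 ∂P with hψ
  have hψ0 : ∀ r, 0 ≤ ψ r := fun r => integral_nonneg fun ω => sq_nonneg _
  have hψm : Monotone ψ := fun r u hru => by
    have := incr hS (le_max_right r 0) (max_le_max_right 0 hru) hB
    have h2 : 0 ≤ ∫ ω in B, (M (max u 0) ω - M (max r 0) ω)^2 ∂P := integral_nonneg fun ω => sq_nonneg _
    simp only [hψ]; linarith
  have hinc : ∀ r, 0 ≤ r → ∫ ω in B, (M (r + ε) ω - M r ω)^2 ∂P = ψ (r + ε) - ψ r := fun r hr => by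
    rw [incr hS hr (by linarith) hB]
    simp only [hψ, max_eq_left hr, max_eq_left (show 0 ≤ r + ε by linarith)]
  set W : ℝ → Ω → ℝ := fun r ω => (M (r + ε) ω - M r ω)^2 with hW
  have hWm : Measurable (Function.uncurry W) := by
    refine measurable_uncurry_of_continuous_of_measurable ?_ ?_
    · intro ω
      have := hS.hM_cont ω
      exact ((this.comp (by fun_prop : Continuous fun r : ℝ => r + ε)).sub this).pow 2
    · intro r
      exact ((M_sm hS _).measurable.sub (M_sm hS _).measurable).pow_const 2
  set ν := (volume : Measure ℝ).restrict (Ioc 0 a) with hν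
  have hWi : Integrable (fun p : Ω × ℝ => W p.2 p.1) ((P.restrict B).prod ν) := by
    have hmm : AEStronglyMeasurable (fun p : Ω × ℝ => W p.2 p.1) ((P.restrict B).prod ν) :=
      (hWm.comp measurable_swap).aestronglyMeasurable
    rw [integrable_prod_iff' hmm]
    constructor
    · rw [hν]
      refine (ae_restrict_mem measurableSet_Ioc).mono fun r hr => ?_
      have hr1 : 0 < r := hr.1
      have hi : Integrable (fun ω => (M (r + ε) ω - M r ω)^2) P :=
        ((M_L2 hS (show 0 ≤ r + ε by linarith)).sub (M_L2 hS hr1.le)).integrable_sq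
      exact hi.integrableOn
    · have h1 : Integrable (fun r => ψ (r + ε) - ψ r) ν := by
        have hφ2 : Monotone fun r => ψ (r + ε) := fun x y h => hψm (by linarith)
        have := (hφ2.intervalIntegrable (μ := volume) (a := 0) (b := a)).sub (hψm.intervalIntegrable)
        rw [intervalIntegrable_iff_integrableOn_Ioc_of_le ha] at this
        exact this
      refine h1.congr ?_
      refine (ae_restrict_mem measurableSet_Ioc).mono fun r hr => ?_
      simp only
      rw [← hinc r hr.1.le]
      refine integral_congr_ae (Eventually.of_forall fun ω => ?_)
      simp only [hW, Real.norm_eq_abs]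
      exact (abs_of_nonneg (sq_nonneg _)).symm
  have e : ucpApproxQC M M ε a = fun ω => (1/ε) * ∫ r, W r ω ∂ν := by
    funext ω; simp only [ucpApproxQC, hW, sq, hν]
  constructor
  · rw [e]
    exact hWi.integral_prod_left.const_mul _
  · rw [e, integral_const_mul, integral_integral_swap (f := fun ω r => W r ω) hWi]
    have h1 : ∫ r, ∫ ω in B, W r ω ∂P ∂ν = ∫ r in Ioc 0 a, (ψ (r + ε) - ψ r) :=
      setIntegral_congr_fun measurableSet_Ioc fun r hr => hinc r hr.1.le
    rw [h1]
    have h2 := mono_shift hψm hψ0 ha hε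
    have h3 : ψ (a + ε) = ∫ ω in B, (M (a + ε) ω)^2 ∂P := by
      simp only [hψ, max_eq_left (show 0 ≤ a + ε by linarith)]
    rw [← h3, one_div, inv_mul_le_iff₀ hε]
    exact h2

lemma Q_le' (hS : SettingNoStop P ℱ X A M Mo σo Io QM QMo) {a t : ℝ} (ha : 0 ≤ a) (hat : a < t) {B : Set Ω}
    (hB : MeasurableSet[gSigmaAll Mo] B) : ∫ ω in B, QM a ω ∂P ≤ ∫ ω in B, (M t ω)^2 ∂P := by
  have ht : 0 < t := ha.trans_lt hat
  have hBm := gAll_le hS.hMo_meas B hB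
  obtain ⟨mk, h0, hmt, hae⟩ := qgood_ae hS.hM_cont hS.hQM ht
  have hε : ∀ k, 0 < t / mk k := fun k => by have := h0 k; positivity
  have hεt : Tendsto (fun k => t / (mk k : ℝ)) atTop (𝓝 0) :=
    tendsto_const_nhds.div_atTop (tendsto_natCast_atTop_atTop.comp hmt)
  obtain ⟨k0, hk0⟩ := eventually_atTop.1 (hεt.eventually (gt_mem_nhds (show 0 < t - a by linarith)))
  have := fatou_int (P := P) (g := fun k => B.indicator (ucpApproxQC M M (t / mk (k + k0)) a))
    (f := B.indicator (QM a)) (C := ∫ ω in B, (M t ω)^2 ∂P)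
    (fun k => (integrable_indicator_iff hBm).2 (qc_B hS ha (hε _) hB).1)
    (fun k => Eventually.of_forall fun ω => Set.indicator_nonneg (fun ω _ => by
      unfold ucpApproxQC
      refine mul_nonneg (one_div_nonneg.2 (hε _).le) (integral_nonneg fun r => mul_self_nonneg _)) ω)
    (fun k => by
      rw [integral_indicator hBm]
      refine (qc_B hS ha (hε _) hB).2.trans ?_
      have h1 := hk0 (k + k0) (by omega)
      have h2 := hε (k + k0)
      have h3 := incr hS (show 0 ≤ a + t / mk (k + k0) by linarith) (show a + t / mk (k + k0) ≤ t by linarith) hB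
      have h4 : 0 ≤ ∫ ω in B, (M t ω - M (a + t / mk (k + k0)) ω)^2 ∂P := integral_nonneg fun ω => sq_nonneg _
      linarith)
    (by
      filter_upwards [hae] with ω h
      by_cases hω : ω ∈ B
      · simp only [Set.indicator_of_mem hω]
        exact (h.tend ⟨ha, hat.le⟩).comp (tendsto_add_atTop_nat k0)
      · simp only [Set.indicator_of_notMem hω]
        exact tendsto_const_nhds)
  rw [integral_indicator hBm] at this
  exact this.2

lemma Q_le (hS : SettingNoStop P ℱ X A M Mo σo Io QM QMo) {t : ℝ} (ht : 0 < t) {B : Set Ω}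
    (hB : MeasurableSet[gSigmaAll Mo] B) : ∫ ω in B, QM t ω ∂P ≤ ∫ ω in B, (M t ω)^2 ∂P := by
  have hBm := gAll_le hS.hMo_meas B hB
  obtain ⟨mk, h0, hmt, hae⟩ := qgood_ae hS.hM_cont hS.hQM ht
  set a : ℕ → ℝ := fun j => t - t / ((j:ℝ) + 1) with ha
  have hp : ∀ j : ℕ, 0 < t / ((j:ℝ) + 1) := fun j => by positivity
  have hlt : ∀ j, a j < t := fun j => by have := hp j; simp only [ha]; linarith
  have ha0 : ∀ j, 0 ≤ a j := fun j => by
    have : t / ((j:ℝ) + 1) ≤ t := div_le_self ht.le (by have : (0:ℝ) ≤ j := Nat.cast_nonneg j; linarith)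
    simp only [ha]; linarith
  have hat : Tendsto a atTop (𝓝 t) := by
    have : Tendsto (fun j : ℕ => t / ((j:ℝ) + 1)) atTop (𝓝 0) :=
      tendsto_const_nhds.div_atTop (tendsto_natCast_atTop_atTop.atTop_add tendsto_const_nhds)
    simpa using tendsto_const_nhds (x := t) |>.sub this
  have := fatou_int (P := P) (g := fun j => B.indicator (QM (a j)))
    (f := B.indicator (QM t)) (C := ∫ ω in B, (M t ω)^2 ∂P)
    (fun j => (qm_integrable hS (ha0 j)).indicator hBm)
    (fun j => by
      filter_upwards [hae] with ω h
      by_cases hω : ω ∈ B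
      · simp only [Set.indicator_of_mem hω]
        exact h.nonneg ⟨ha0 j, (hlt j).le⟩
      · simp only [Set.indicator_of_notMem hω]
        exact le_rfl)
    (fun j => by
      rw [integral_indicator hBm]
      exact Q_le' hS (ha0 j) (hlt j) hB)
    (by
      filter_upwards [hae] with ω h
      by_cases hω : ω ∈ B
      · simp only [Set.indicator_of_mem hω]
        have h1 : ContinuousWithinAt (fun s => QM s ω) (Icc 0 t) t := h.cont t ⟨ht.le, le_rfl⟩
        refine h1.tendsto.comp (tendsto_nhdsWithin_iff.2 ⟨hat, Eventually.of_forall fun j => ⟨ha0 j, (hlt j).le⟩⟩)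
      · simp only [Set.indicator_of_notMem hω]
        exact tendsto_const_nhds)
  rw [integral_indicator hBm] at this
  exact this.2

lemma Q_eq (hS : SettingNoStop P ℱ X A M Mo σo Io QM QMo) {t : ℝ} (ht : 0 ≤ t) {B : Set Ω}
    (hB : MeasurableSet[gSigmaAll Mo] B) : ∫ ω in B, QM t ω ∂P = ∫ ω in B, (M t ω)^2 ∂P := by
  have hBm := gAll_le hS.hMo_meas B hB
  rcases ht.eq_or_lt with h | h
  · subst h
    obtain ⟨mk, h0, hmt, hae⟩ := qgood_ae hS.hM_cont hS.hQM one_pos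
    rw [setIntegral_congr_ae hBm (g := fun _ => (0:ℝ)) (by filter_upwards [hae] with ω h _ using h.zero)]
    simp [hS.hM0]
  · have h1 := Q_le hS h hB
    have h2 := Q_le hS h hB.compl
    have h3 := (M_sq hS h).2
    rw [← integral_add_compl hBm (qm_integrable hS ht), ← integral_add_compl hBm (M_sqi hS ht)] at h3
    linarith
end

/-- **Lemma 2.12(ii) (conditional Itô isometry).** Under Assumption (A) and Condition (L),
`E[(M_t - M_s)² | 𝒢] = E[[M]_t - [M]_s | 𝒢]` a.s. for all `t ≥ s ≥ 0`. -/
theorem conditional_ito_isometry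
    (P : Measure Ω) [IsProbabilityMeasure P] (ℱ : Filtration ℝ m0)
    (X A M Mo σo Io QM QMo : ℝ → Ω → ℝ)
    (hS : SettingNoStop P ℱ X A M Mo σo Io QM QMo) :
    ∀ s t : ℝ, 0 ≤ s → s ≤ t →
      P[fun ω => (M t ω - M s ω)^2 | gSigmaAll Mo]
        =ᵐ[P] P[fun ω => QM t ω - QM s ω | gSigmaAll Mo] := by
  intro s t hs hst
  have ht := hs.trans hst
  have hmA := gAll_le hS.hMo_meas
  have hi1 : Integrable (fun ω => (M t ω - M s ω)^2) P := ((M_L2 hS ht).sub (M_L2 hS hs)).integrable_sq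
  have hi2 : Integrable (fun ω => QM t ω - QM s ω) P := (qm_integrable hS ht).sub (qm_integrable hS hs)
  refine ae_eq_condExp_of_forall_setIntegral_eq hmA hi2 (fun _ _ _ => integrable_condExp.integrableOn) ?_
    stronglyMeasurable_condExp.aestronglyMeasurable
  intro B hB _
  rw [setIntegral_condExp hmA hi1 hB, incr hS hs hst hB,
    integral_sub (qm_integrable hS ht).integrableOn (qm_integrable hS hs).integrableOn, Q_eq hS ht hB, Q_eq hS hs hB]

end PaperC1Ito
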